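/- arXiv:2410.06378 — 2 statements merged into one kernel-verified Lean document; each statement's English description precedes it below -/
import Mathlib

section
/- There exists an absolute constant C ∈ ℝ_+ such that for all d, W, L ∈ ℕ with W ≥ d and W, L ≥ 2, every probability distribution P on ℝ^d, and every ε ∈ (0, 1/2), the covering number of the class of output-truncated ReLU network realizations satisfies log N(ε, T_1 ∘ R(d,W,L), L²(P)) ≤ C · W²L² · log(WL) · log(ε^{−1}). -/
open MeasureTheory ProbabilityTheory ENNReal

noncomputable section

/-- A ReLU network configuration with input dimension `d`:
a finite sequence of matrix–vector pairs `(A_i, b_i)`, `i = 0, …, depth − 1`. -/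
structure ReLUNet (d : ℕ) where
  depth : ℕ
  depth_pos : 0 < depth
  width : ℕ → ℕ
  width_in : width 0 = d
  width_out : width depth = 1
  A : ∀ i : ℕ, Matrix (Fin (width (i + 1))) (Fin (width i)) ℝ
  b : ∀ i : ℕ, Fin (width (i + 1)) → ℝ

namespace ReLUNet

variable {d : ℕ}

/-- The affine map `x ↦ A_i x + b_i` of layer `i`. -/
def layer (Φ : ReLUNet d) (i : ℕ) (x : Fin (Φ.width i) → ℝ) :
    Fin (Φ.width (i + 1)) → ℝ :=
  fun j => (∑ k, Φ.A i j k * x k) + Φ.b i j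

/-- Output after the first `i` affine layers, with the ReLU activation `ρ(x) = max{x,0}`
applied between consecutive affine layers (not on the input and not after the last
affine layer). -/
def forward (Φ : ReLUNet d) : (i : ℕ) → (Fin (Φ.width 0) → ℝ) → Fin (Φ.width i) → ℝ
  | 0, x => x
  | i + 1, x =>
      Φ.layer i fun k => if i = 0 then Φ.forward i x k else max (Φ.forward i x k) 0

/-- The realization `R(Φ) : ℝ^d → ℝ` of a network configuration. -/
def realization (Φ : ReLUNet d) (x : Fin d → ℝ) : ℝ :=
  Φ.forward Φ.depth (fun k => x (Fin.cast Φ.width_in k)) (Fin.cast Φ.width_out.symm 0)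

/-- All layer widths are at most `W`. -/
def widthLe (Φ : ReLUNet d) (W : ℕ) : Prop :=
  ∀ i ≤ Φ.depth, Φ.width i ≤ W

/-- All weights have absolute value at most `B`. -/
def magLe (Φ : ReLUNet d) (B : ℝ) : Prop :=
  ∀ i < Φ.depth, (∀ j k, |Φ.A i j k| ≤ B) ∧ ∀ j, |Φ.b i j| ≤ B

/-- All weights take values in the set `𝔸`. -/
def coefIn (Φ : ReLUNet d) (𝔸 : Set ℝ) : Prop :=
  ∀ i < Φ.depth, (∀ j k, Φ.A i j k ∈ 𝔸) ∧ ∀ j, Φ.b i j ∈ 𝔸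

open Classical in
/-- The connectivity (total number of nonzero weights) of a network configuration. -/
def connectivity (Φ : ReLUNet d) : ℕ :=
  ∑ i ∈ Finset.range Φ.depth,
    ((Finset.univ.filter fun jk : Fin (Φ.width (i + 1)) × Fin (Φ.width i) =>
        Φ.A i jk.1 jk.2 ≠ 0).card
      + (Finset.univ.filter fun j : Fin (Φ.width (i + 1)) => Φ.b i j ≠ 0).card)

end ReLUNet

/-- `R(d,W,L,B)`: realizations of ReLU networks with input dimension `d`, output
dimension 1, width at most `W`, depth at most `L`, and weight magnitude at most `B`. -/
def RclassB (d W L : ℕ) (B : ℝ) : Set ((Fin d → ℝ) → ℝ) :=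
  {f | ∃ Φ : ReLUNet d, Φ.widthLe W ∧ Φ.depth ≤ L ∧ Φ.magLe B ∧ Φ.realization = f}

/-- `R(d,W,L)`: realizations with width at most `W` and depth at most `L`,
with no constraint on the weight magnitude. -/
def Rclass (d W L : ℕ) : Set ((Fin d → ℝ) → ℝ) :=
  {f | ∃ Φ : ReLUNet d, Φ.widthLe W ∧ Φ.depth ≤ L ∧ Φ.realization = f}

/-- `R_𝔸(d,W,L)`: realizations with width at most `W`, depth at most `L`, and all
weights taking values in `𝔸`. -/
def RclassCoef (d W L : ℕ) (𝔸 : Set ℝ) : Set ((Fin d → ℝ) → ℝ) :=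
  {f | ∃ Φ : ReLUNet d, Φ.widthLe W ∧ Φ.depth ≤ L ∧ Φ.coefIn 𝔸 ∧ Φ.realization = f}

/-- `R(d,W,L,B,s)`: realizations with width ≤ `W`, depth ≤ `L`, weight magnitude ≤ `B`,
and connectivity ≤ `s`. -/
def RclassSparse (d W L : ℕ) (B : ℝ) (s : ℕ) : Set ((Fin d → ℝ) → ℝ) :=
  {f | ∃ Φ : ReLUNet d, Φ.widthLe W ∧ Φ.depth ≤ L ∧ Φ.magLe B ∧
    Φ.connectivity ≤ s ∧ Φ.realization = f}

/-- The unit cube `[0,1]^d`. -/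
def unitCube (d : ℕ) : Set (Fin d → ℝ) := Set.univ.pi fun _ => Set.Icc (0 : ℝ) 1

/-- The `L^p([0,1]^d)` distance between two functions on `ℝ^d` (with `p = ⊤`
corresponding to `L^∞`). -/
def cubeDist (d : ℕ) (p : ℝ≥0∞) (f g : (Fin d → ℝ) → ℝ) : ℝ≥0∞ :=
  eLpNorm (f - g) p (volume.restrict (unitCube d))

/-- The `L^p([0,1])` distance between two functions on `ℝ`. -/
def intervalDist (p : ℝ≥0∞) (f g : ℝ → ℝ) : ℝ≥0∞ :=
  eLpNorm (f - g) p (volume.restrict (Set.Icc (0 : ℝ) 1))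

/-- The `ε`-covering number of `X` with respect to the extended distance `δ`:
the cardinality of a smallest subset `C ⊆ X` such that every point of `X` is within
distance `ε` of some point of `C` (equal to `⊤` if no finite covering exists). -/
def coveringNumber {α : Type*} (ε : ℝ≥0∞) (X : Set α) (δ : α → α → ℝ≥0∞) : ℕ∞ :=
  sInf {n : ℕ∞ | ∃ C : Finset α, ↑C ⊆ X ∧ (∀ x ∈ X, ∃ c ∈ C, δ x c ≤ ε) ∧ (C.card : ℕ∞) = n}

/-- The `ε`-packing number of `X` with respect to the extended distance `δ`:
the cardinality of a largest subset of `X` whose points have pairwise distances `> ε`. -/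
def packingNumber {α : Type*} (ε : ℝ≥0∞) (X : Set α) (δ : α → α → ℝ≥0∞) : ℕ∞ :=
  sSup {n : ℕ∞ | ∃ C : Finset α, ↑C ⊆ X ∧
    (∀ x ∈ C, ∀ y ∈ C, x ≠ y → ε < δ x y) ∧ (C.card : ℕ∞) = n}

/-- Base-2 logarithm of an extended natural number, valued in `ℝ≥0∞`. -/
def elog2 (n : ℕ∞) : ℝ≥0∞ :=
  if n = ⊤ then ⊤ else ENNReal.ofReal (Real.logb 2 (n.toNat : ℝ))

/-- The minimax approximation error `A(G, F, δ) = sup_{g ∈ G} inf_{f ∈ F} δ(f, g)`. -/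
def minimaxErr {α : Type*} (G F : Set α) (δ : α → α → ℝ≥0∞) : ℝ≥0∞ :=
  ⨆ g ∈ G, ⨅ f ∈ F, δ f g

/-- The truncation operator `T_E(x) = max{−E, min{E, x}}`. -/
def trunc (E x : ℝ) : ℝ := max (-E) (min E x)

/-- `T_E ∘ F = {T_E ∘ f : f ∈ F}`. -/
def truncClass {α : Type*} (E : ℝ) (F : Set (α → ℝ)) : Set (α → ℝ) :=
  (fun f => trunc E ∘ f) '' F

/-- The `L²(P)` distance between two functions. -/
def L2dist {α : Type*} [MeasurableSpace α] (P : MeasureTheory.Measure α) (f g : α → ℝ) :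
    ℝ≥0∞ :=
  MeasureTheory.eLpNorm (f - g) 2 P

section PolynomialSigns

variable {σ : Type*} [Fintype σ]

/-- On a finite set `Z` where every `m`-th coordinate power agrees with a polynomial of degree
`< m`, every monomial is a combination of monomials with all exponents `< m`. -/
lemma monomial_mem_span_of_pow_eq (m : ℕ) (q : σ → MvPolynomial σ ℝ)
    (hq : ∀ j, (q j).totalDegree < m) (Z : Finset (σ → ℝ))
    (hZ : ∀ z ∈ Z, ∀ j, z j ^ m = MvPolynomial.eval z (q j)) (t : ℕ) :
    ∀ α : σ →₀ ℕ, α.degree = t →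
      (fun z : Z => ∏ j, z.1 j ^ α j) ∈ Submodule.span ℝ
        (Set.range fun (e : σ → Fin m) (z : Z) => ∏ j, z.1 j ^ (e j : ℕ)) := by
  classical
  induction t using Nat.strong_induction_on with
  | _ t ih =>
    intro α hα
    by_cases h : ∀ j, α j < m
    · exact Submodule.subset_span ⟨fun j => ⟨α j, h j⟩, rfl⟩
    · push Not at h
      obtain ⟨j, hj⟩ := h
      set β : σ →₀ ℕ := α - Finsupp.single j m with hβ
      have hαβ : α = β + Finsupp.single j m := by
        rw [hβ, tsub_add_cancel_of_le]
        simpa using hj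
      have hdeg : β.degree + m = t := by
        rw [← hα, hαβ, map_add, Finsupp.degree_single]
      have key : (fun z : Z => ∏ i, z.1 i ^ α i) =
          ∑ γ ∈ (q j).support, (q j).coeff γ • fun z : Z => ∏ i, z.1 i ^ (β + γ) i := by
        funext z
        have hprod : ∏ i, z.1 i ^ α i = (∏ i, z.1 i ^ β i) * z.1 j ^ m := by
          rw [hαβ]
          simp only [Finsupp.add_apply, pow_add, Finset.prod_mul_distrib]
          congr 1
          rw [Finset.prod_eq_single j] <;> simp +contextual [eq_comm]
        rw [hprod, hZ z.1 z.2 j, MvPolynomial.eval_eq', Finset.mul_sum]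
        simp only [Finset.sum_apply, Pi.smul_apply, smul_eq_mul, Finsupp.add_apply, pow_add,
          Finset.prod_mul_distrib]
        exact Finset.sum_congr rfl fun γ _ => by ring
      rw [key]
      refine Submodule.sum_mem _ fun γ hγ => Submodule.smul_mem _ _ ?_
      refine ih _ ?_ (β + γ) rfl
      have : γ.degree ≤ (q j).totalDegree := MvPolynomial.le_totalDegree hγ
      have := hq j
      rw [map_add]
      omega

/-- Weak Bézout bound: a system `z_j ^ m = q_j(z)` with `deg q_j < m` has at most `m ^ |σ|`
real solutions. -/
lemma card_le_of_pow_eq (m : ℕ) (q : σ → MvPolynomial σ ℝ)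
    (hq : ∀ j, (q j).totalDegree < m) (Z : Finset (σ → ℝ))
    (hZ : ∀ z ∈ Z, ∀ j, z j ^ m = MvPolynomial.eval z (q j)) :
    Z.card ≤ m ^ Fintype.card σ := by
  classical
  set V := Submodule.span ℝ
    (Set.range fun (e : σ → Fin m) (z : Z) => ∏ j, z.1 j ^ (e j : ℕ)) with hV
  have hpoly : ∀ p : MvPolynomial σ ℝ, (fun z : Z => MvPolynomial.eval z.1 p) ∈ V := by
    intro p
    have : (fun z : Z => MvPolynomial.eval z.1 p) =
        ∑ γ ∈ p.support, p.coeff γ • fun z : Z => ∏ i, z.1 i ^ γ i := by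
      funext z
      simp [MvPolynomial.eval_eq']
    rw [this]
    exact Submodule.sum_mem _ fun γ _ => Submodule.smul_mem _ _
      (monomial_mem_span_of_pow_eq m q hq Z hZ _ γ rfl)
  have htop : V = ⊤ := by
    rw [eq_top_iff]
    intro g _
    have hsep : ∀ w : Z, Pi.single w (1 : ℝ) ∈ V := by
      intro w
      set r : MvPolynomial σ ℝ := ∏ v ∈ Finset.univ.erase w,
        ∑ j, (MvPolynomial.X j - MvPolynomial.C (v.1 j)) ^ 2 with hr
      have heval : ∀ z : Z, MvPolynomial.eval z.1 r =
          ∏ v ∈ Finset.univ.erase w, ∑ j, (z.1 j - v.1 j) ^ 2 := by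
        intro z
        simp [hr, map_prod]
      have hw : MvPolynomial.eval w.1 r ≠ 0 := by
        rw [heval, Finset.prod_ne_zero_iff]
        intro v hv h0
        rw [Finset.sum_eq_zero_iff_of_nonneg fun _ _ => sq_nonneg _] at h0
        apply (Finset.mem_erase.1 hv).1
        ext j
        have := h0 j (Finset.mem_univ j)
        rw [sq_eq_zero_iff, sub_eq_zero] at this
        exact this.symm
      have : Pi.single w (1 : ℝ) =
          (MvPolynomial.eval w.1 r)⁻¹ • fun z : Z => MvPolynomial.eval z.1 r := by
        funext z
        by_cases hz : z = w
        · subst hz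
          simp [hw]
        · have : MvPolynomial.eval z.1 r = 0 := by
            rw [heval]
            exact Finset.prod_eq_zero (Finset.mem_erase.2 ⟨hz, Finset.mem_univ z⟩) (by simp)
          simp [hz, this]
      rw [this]
      exact Submodule.smul_mem _ _ (hpoly r)
    have : g = ∑ w : Z, g w • Pi.single w (1 : ℝ) := by
      funext z
      simp [Finset.sum_apply, Pi.single_apply]
    rw [this]
    exact Submodule.sum_mem _ fun w _ => Submodule.smul_mem _ _ (hsep w)
  have h1 : Module.finrank ℝ V ≤ Fintype.card (σ → Fin m) := finrank_range_le_card _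
  rw [htop, finrank_top, Module.finrank_fintype_fun_eq_card] at h1
  simpa using h1

lemma hasDerivAt_eval_update {σ : Type*} [DecidableEq σ] (p : MvPolynomial σ ℝ) (z : σ → ℝ) (j : σ) :
    HasDerivAt (fun t => MvPolynomial.eval (Function.update z j t) p)
      (MvPolynomial.eval z (MvPolynomial.pderiv j p)) (z j) := by
  induction p using MvPolynomial.induction_on with
  | C a => simpa using hasDerivAt_const (z j) a
  | add p q hp hq =>
    simp only [map_add]
    exact hp.add hq
  | mul_X p i hp =>
    have hX : HasDerivAt (fun t => Function.update z j t i) (if i = j then 1 else 0) (z j) := by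
      by_cases h : i = j
      · subst h
        simpa using! hasDerivAt_id (z i)
      · simpa [h] using hasDerivAt_const (z j) (z i)
    convert! hp.mul hX using 1
    · funext t
      simp
    · by_cases h : i = j
      · subst h
        simp [add_comm, mul_comm]
      · simp [h, mul_comm]

lemma abs_eval_le (p : MvPolynomial σ ℝ) (x : σ → ℝ) :
    |MvPolynomial.eval x p| ≤
      (∑ γ ∈ p.support, |p.coeff γ|) * max 1 ‖x‖ ^ p.totalDegree := by
  rw [MvPolynomial.eval_eq', Finset.sum_mul]
  refine (Finset.abs_sum_le_sum_abs _ _).trans (Finset.sum_le_sum fun γ hγ => ?_)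
  rw [abs_mul, Finset.abs_prod]
  refine mul_le_mul_of_nonneg_left ?_ (abs_nonneg _)
  have hγ' : ∑ i, γ i ≤ p.totalDegree := by
    have := MvPolynomial.le_totalDegree hγ
    rwa [Finsupp.sum_fintype _ _ (fun _ => rfl)] at this
  calc ∏ i, |x i ^ γ i| ≤ ∏ i, max 1 ‖x‖ ^ γ i := by
        refine Finset.prod_le_prod (fun _ _ => abs_nonneg _) fun i _ => ?_
        rw [abs_pow]
        gcongr
        exact (norm_le_pi_norm x i).trans (le_max_right _ _)
    _ = max 1 ‖x‖ ^ ∑ i, γ i := Finset.prod_pow_eq_pow_sum _ _ _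
    _ ≤ _ := pow_le_pow_right₀ (le_max_left _ _) hγ'

/-- Adding an even power sum of higher degree makes a polynomial nonnegative near infinity. -/
lemma eventually_nonneg_add_pow (p : MvPolynomial σ ℝ) (c : ℝ) (hc : 0 < c) (K : ℕ)
    (hK : p.totalDegree < 2 * K) :
    ∀ᶠ x in Filter.cocompact (σ → ℝ),
      0 ≤ MvPolynomial.eval x p + c * ∑ j, x j ^ (2 * K) := by
  set M := ∑ γ ∈ p.support, |p.coeff γ| with hM
  filter_upwards [(tendsto_norm_cocompact_atTop (E := σ → ℝ)).eventually_ge_atTop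
    (max 1 (M / c))] with x hx
  have h1 : 1 ≤ ‖x‖ := (le_max_left _ _).trans hx
  have h2 : M ≤ ‖x‖ * c := (div_le_iff₀ hc).1 ((le_max_right _ _).trans hx)
  have hM0 : 0 ≤ M := Finset.sum_nonneg fun _ _ => abs_nonneg _
  have hp := abs_eval_le p x
  rw [max_eq_right h1] at hp
  have hsum : ‖x‖ ^ (2 * K) ≤ ∑ j, x j ^ (2 * K) := by
    have hne : Nonempty σ := by
      by_contra h
      rw [not_nonempty_iff] at h
      rw [Subsingleton.elim x 0, norm_zero] at h1
      linarith
    obtain ⟨j, -, hj⟩ := Finset.exists_max_image Finset.univ (fun j => ‖x j‖)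
      Finset.univ_nonempty
    have hxj : ‖x‖ ≤ ‖x j‖ := (pi_norm_le_iff_of_nonneg (norm_nonneg _)).2 fun i =>
      hj i (Finset.mem_univ i)
    calc ‖x‖ ^ (2 * K) ≤ ‖x j‖ ^ (2 * K) := by gcongr
      _ = x j ^ (2 * K) := by rw [Real.norm_eq_abs, Even.pow_abs (even_two_mul K)]
      _ ≤ _ := Finset.single_le_sum (f := fun j => x j ^ (2 * K))
          (fun i _ => (even_two_mul K).pow_nonneg _) (Finset.mem_univ j)
  have hle : M * ‖x‖ ^ p.totalDegree ≤ c * ‖x‖ ^ (2 * K) := by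
    calc M * ‖x‖ ^ p.totalDegree ≤ (‖x‖ * c) * ‖x‖ ^ p.totalDegree := by gcongr
      _ = c * ‖x‖ ^ (p.totalDegree + 1) := by ring
      _ ≤ c * ‖x‖ ^ (2 * K) := by gcongr; omega
  have := neg_abs_le (MvPolynomial.eval x p)
  have := mul_le_mul_of_nonneg_left hsum hc.le
  linarith

/-- In every sign cell of `∏ f_k ≠ 0` there is a critical point of `-(∏ f_k)² + c ∑ x_j ^ (2K)`,
provided the latter is negative somewhere in the cell. -/
lemma exists_critical_point {κ : Type*} [Fintype κ] (f : κ → MvPolynomial σ ℝ) (c : ℝ)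
    (hc : 0 < c) (K : ℕ) (hK : (-(∏ k, f k) ^ 2).totalDegree < 2 * K) (θ : σ → ℝ)
    (hθ : c * ∑ j, θ j ^ (2 * K) < (∏ k, MvPolynomial.eval θ (f k)) ^ 2) :
    ∃ z : σ → ℝ, (∀ k, 0 < MvPolynomial.eval z (f k) ↔ 0 < MvPolynomial.eval θ (f k)) ∧
      ∀ j, MvPolynomial.eval z (MvPolynomial.pderiv j ((∏ k, f k) ^ 2)) =
        c * ((2 * K : ℕ) * z j ^ (2 * K - 1)) := by
  classical
  set Q : MvPolynomial σ ℝ := -(∏ k, f k) ^ 2 +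
    MvPolynomial.C c * ∑ j, MvPolynomial.X j ^ (2 * K) with hQ
  have hQe : ∀ x, MvPolynomial.eval x Q =
      -(∏ k, MvPolynomial.eval x (f k)) ^ 2 + c * ∑ j, x j ^ (2 * K) := by
    intro x
    simp [hQ, map_prod]
  set A : Set (σ → ℝ) :=
    {x | ∀ k, 0 ≤ MvPolynomial.eval θ (f k) * MvPolynomial.eval x (f k)} with hA
  have hAc : IsClosed A := by
    simp only [hA, Set.ofPred_forall]
    exact isClosed_iInter fun k => isClosed_le continuous_const
      (continuous_const.mul (MvPolynomial.continuous_eval _))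
  have hθA : θ ∈ A := fun k => mul_self_nonneg _
  have hθQ : MvPolynomial.eval θ Q < 0 := by rw [hQe]; linarith
  obtain ⟨z, hzA, hz⟩ := (MvPolynomial.continuous_eval Q).continuousOn.exists_isMinOn' hAc hθA (by
    refine Filter.Eventually.filter_mono inf_le_left ?_
    filter_upwards [eventually_nonneg_add_pow _ c hc K hK] with x hx
    refine hθQ.le.trans ?_
    rw [hQe]
    simpa [map_prod] using hx)
  have hzQ : MvPolynomial.eval z Q < 0 := (hz hθA).trans_lt hθQ
  have hsum : ∀ x : σ → ℝ, 0 ≤ c * ∑ j, x j ^ (2 * K) := fun x =>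
    mul_nonneg hc.le (Finset.sum_nonneg fun j _ => (even_two_mul K).pow_nonneg _)
  have hzf : ∀ k, MvPolynomial.eval z (f k) ≠ 0 := by
    intro k hk
    rw [hQe, Finset.prod_eq_zero (Finset.mem_univ k) hk] at hzQ
    have := hsum z
    simp at hzQ
    linarith
  have hθf : ∀ k, MvPolynomial.eval θ (f k) ≠ 0 := by
    intro k hk
    rw [Finset.prod_eq_zero (Finset.mem_univ k) hk] at hθ
    have := hsum θ
    simp at hθ
    linarith
  have hpos : ∀ k, 0 < MvPolynomial.eval θ (f k) * MvPolynomial.eval z (f k) := fun k =>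
    lt_of_le_of_ne (hzA k) (mul_ne_zero (hθf k) (hzf k)).symm
  have hnhds : A ∈ nhds z := by
    have : ∀ᶠ x in nhds z, ∀ k,
        0 < MvPolynomial.eval θ (f k) * MvPolynomial.eval x (f k) :=
      Filter.eventually_all.2 fun k =>
        (continuous_const.mul (MvPolynomial.continuous_eval (f k))).continuousAt.eventually
          (lt_mem_nhds (hpos k))
    filter_upwards [this] with x hx k using (hx k).le
  have hloc : IsLocalMin (fun x => MvPolynomial.eval x Q) z := hz.isLocalMin hnhds
  refine ⟨z, fun k => ?_, fun j => ?_⟩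
  · constructor <;> intro h
    · exact (pos_iff_pos_of_mul_pos (hpos k)).2 h
    · exact (pos_iff_pos_of_mul_pos (hpos k)).1 h
  · have hcont : ContinuousAt (fun t => Function.update z j t) (z j) :=
      (continuous_const.update j continuous_id).continuousAt
    have hloc' : IsLocalMin (fun t => MvPolynomial.eval (Function.update z j t) Q) (z j) := by
      have := hcont.tendsto
      rw [Function.update_eq_self] at this
      have h2 := this.eventually hloc
      simpa [IsLocalMin, IsMinFilter] using h2
    have h0 := hloc'.hasDerivAt_eq_zero (hasDerivAt_eval_update Q z j)
    have hder : MvPolynomial.pderiv j Q = -MvPolynomial.pderiv j ((∏ k, f k) ^ 2) +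
        MvPolynomial.C c * (((2 * K : ℕ) : MvPolynomial σ ℝ) * MvPolynomial.X j ^ (2 * K - 1)) := by
      simp only [hQ, map_add, map_neg, MvPolynomial.pderiv_C_mul, map_sum]
      congr 2
      rw [Finset.sum_eq_single j]
      · rw [MvPolynomial.pderiv_pow, MvPolynomial.pderiv_X_self, mul_one]
      · intro i _ hi
        rw [MvPolynomial.pderiv_pow, MvPolynomial.pderiv_X_of_ne hi, mul_zero]
      · simp
    rw [hder] at h0
    simp only [map_add, map_neg, map_mul, MvPolynomial.eval_C, map_natCast, map_pow,
      MvPolynomial.eval_X] at h0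
    linarith

lemma totalDegree_pderiv_le {σ : Type*} (p : MvPolynomial σ ℝ) (j : σ) :
    (MvPolynomial.pderiv j p).totalDegree ≤ p.totalDegree := by
  classical
  conv_lhs => rw [p.as_sum, map_sum]
  refine MvPolynomial.totalDegree_finsetSum_le fun γ hγ => ?_
  rw [MvPolynomial.pderiv_monomial]
  refine (MvPolynomial.totalDegree_monomial_le _ _).trans
    (le_trans ?_ (MvPolynomial.le_totalDegree hγ))
  exact Finsupp.degree_mono (tsub_le_self : γ - Finsupp.single j 1 ≤ γ)

/-- Points with pairwise distinct sign patterns, all polynomials being nonzero at them. -/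
lemma card_le_of_injOn_sign_of_ne_zero {κ : Type*} [Fintype κ] (f : κ → MvPolynomial σ ℝ)
    (D : ℕ) (hf : ∀ k, (f k).totalDegree ≤ D) (S : Finset (σ → ℝ))
    (hS : ∀ θ ∈ S, ∀ k, MvPolynomial.eval θ (f k) ≠ 0)
    (hinj : Set.InjOn (fun θ k => 0 < MvPolynomial.eval θ (f k)) (S : Set (σ → ℝ))) :
    S.card ≤ (2 * (Fintype.card κ * D) + 1) ^ Fintype.card σ := by
  classical
  set K := Fintype.card κ * D + 1 with hK
  have hdeg : ((∏ k, f k) ^ 2).totalDegree ≤ 2 * (Fintype.card κ * D) := by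
    refine (MvPolynomial.totalDegree_pow _ _).trans (Nat.mul_le_mul_left 2 ?_)
    refine (MvPolynomial.totalDegree_finsetProd _ _).trans ?_
    refine (Finset.sum_le_card_nsmul _ _ D fun k _ => hf k).trans ?_
    simp
  obtain ⟨c, hc, hcS⟩ : ∃ c : ℝ, 0 < c ∧ ∀ θ ∈ S,
      c * ∑ j, θ j ^ (2 * K) < (∏ k, MvPolynomial.eval θ (f k)) ^ 2 := by
    have : ∀ᶠ c : ℝ in nhdsWithin 0 (Set.Ioi 0), ∀ θ ∈ S,
        c * ∑ j, θ j ^ (2 * K) < (∏ k, MvPolynomial.eval θ (f k)) ^ 2 := by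
      rw [Filter.eventually_all_finset]
      intro θ hθ
      have hpos : 0 < (∏ k, MvPolynomial.eval θ (f k)) ^ 2 :=
        sq_pos_of_ne_zero (Finset.prod_ne_zero_iff.2 fun k _ => hS θ hθ k)
      have ht : Filter.Tendsto (fun c : ℝ => c * ∑ j, θ j ^ (2 * K))
          (nhdsWithin 0 (Set.Ioi 0)) (nhds 0) := by
        have : Continuous fun c : ℝ => c * ∑ j, θ j ^ (2 * K) := by fun_prop
        simpa using (this.tendsto 0).mono_left nhdsWithin_le_nhds
      exact ht.eventually (gt_mem_nhds hpos)
    obtain ⟨c, hc, hc0⟩ := (this.and self_mem_nhdsWithin).exists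
    exact ⟨c, hc0, hc⟩
  have hcrit : ∀ θ : σ → ℝ, ∃ z : σ → ℝ, θ ∈ S →
      (∀ k, 0 < MvPolynomial.eval z (f k) ↔ 0 < MvPolynomial.eval θ (f k)) ∧
      ∀ j, MvPolynomial.eval z (MvPolynomial.pderiv j ((∏ k, f k) ^ 2)) =
        c * ((2 * K : ℕ) * z j ^ (2 * K - 1)) := by
    intro θ
    by_cases hθ : θ ∈ S
    · obtain ⟨z, hz⟩ := exists_critical_point f c hc K
        (by rw [MvPolynomial.totalDegree_neg]; omega) θ (hcS θ hθ)
      exact ⟨z, fun _ => hz⟩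
    · exact ⟨θ, fun h => absurd h hθ⟩
  choose z hz using hcrit
  have hzinj : Set.InjOn z (S : Set (σ → ℝ)) := by
    intro θ hθ θ' hθ' h
    refine hinj hθ hθ' (funext fun k => propext ?_)
    beta_reduce
    rw [← (hz θ hθ).1 k, h, (hz θ' hθ').1 k]
  rw [← Finset.card_image_of_injOn hzinj]
  refine card_le_of_pow_eq (2 * (Fintype.card κ * D) + 1)
    (fun j => MvPolynomial.C (c * (2 * K : ℕ))⁻¹ * MvPolynomial.pderiv j ((∏ k, f k) ^ 2))
    (fun j => ?_) _ fun w hw j => ?_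
  · refine Nat.lt_succ_of_le ((MvPolynomial.totalDegree_mul _ _).trans ?_)
    rw [MvPolynomial.totalDegree_C, zero_add]
    exact (totalDegree_pderiv_le _ _).trans hdeg
  · obtain ⟨θ, hθ, rfl⟩ := Finset.mem_image.1 hw
    rw [map_mul, MvPolynomial.eval_C, (hz θ hθ).2 j]
    have hK0 : c * (2 * K : ℕ) ≠ 0 := by positivity
    have h2 : 2 * K - 1 = 2 * (Fintype.card κ * D) + 1 := by omega
    rw [h2, ← mul_assoc c, inv_mul_cancel_left₀ hK0]

/-- Warren-type bound: the number of sign patterns (positive versus nonpositive) of finitely many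
polynomials of bounded degree. -/
lemma card_le_of_injOn_sign {κ : Type*} [Fintype κ] (p : κ → MvPolynomial σ ℝ)
    (D : ℕ) (hp : ∀ k, (p k).totalDegree ≤ D) (S : Finset (σ → ℝ))
    (hinj : Set.InjOn (fun θ k => 0 < MvPolynomial.eval θ (p k)) (S : Set (σ → ℝ))) :
    S.card ≤ (2 * (Fintype.card κ * D) + 1) ^ Fintype.card σ := by
  obtain ⟨δ, hδ, hδS⟩ : ∃ δ : ℝ, 0 < δ ∧ ∀ θ ∈ S, ∀ k,
      0 < MvPolynomial.eval θ (p k) → δ < MvPolynomial.eval θ (p k) := by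
    have : ∀ᶠ δ : ℝ in nhdsWithin 0 (Set.Ioi 0), ∀ θ ∈ S, ∀ k,
        0 < MvPolynomial.eval θ (p k) → δ < MvPolynomial.eval θ (p k) := by
      rw [Filter.eventually_all_finset]
      intro θ _
      refine Filter.eventually_all.2 fun k => ?_
      by_cases h : 0 < MvPolynomial.eval θ (p k)
      · filter_upwards [nhdsWithin_le_nhds (gt_mem_nhds h)] with δ hδ _ using hδ
      · exact Filter.Eventually.of_forall fun δ h' => absurd h' h
    obtain ⟨δ, h, hδ⟩ := (this.and self_mem_nhdsWithin).exists
    exact ⟨δ, hδ, h⟩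
  have hiff : ∀ θ ∈ S, ∀ k, 0 < MvPolynomial.eval θ (p k - MvPolynomial.C δ) ↔
      0 < MvPolynomial.eval θ (p k) := by
    intro θ hθ k
    rw [map_sub, MvPolynomial.eval_C, sub_pos]
    exact ⟨hδ.trans, hδS θ hθ k⟩
  refine card_le_of_injOn_sign_of_ne_zero (fun k => p k - MvPolynomial.C δ) D (fun k => ?_) S
    (fun θ hθ k h0 => ?_) fun θ hθ θ' hθ' h => hinj hθ hθ' (funext fun k => propext ?_)
  · exact (MvPolynomial.totalDegree_sub_C_le _ _).trans (hp k)
  · have h1 := hiff θ hθ k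
    rw [map_sub, MvPolynomial.eval_C, sub_eq_zero] at h0
    rw [map_sub, MvPolynomial.eval_C, h0, sub_self] at h1
    exact (lt_irrefl 0) (h1.2 hδ)
  · beta_reduce
    rw [← hiff θ hθ k, ← hiff θ' hθ' k]
    exact iff_of_eq (congrFun h k)

end PolynomialSigns

section ParameterizedNetworks

lemma card_le_mul_of_injOn_prod {Θ α β : Type*} (f : Θ → α) (g : Θ → β) (M B : ℕ)
    (hf : ∀ T : Finset Θ, Set.InjOn f (T : Set Θ) → T.card ≤ M)
    (hg : ∀ a, ∀ T : Finset Θ, (∀ θ ∈ T, f θ = a) → Set.InjOn g (T : Set Θ) → T.card ≤ B)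
    (S : Finset Θ) (hS : Set.InjOn (fun θ => (f θ, g θ)) (S : Set Θ)) : S.card ≤ B * M := by
  classical
  have himg : (S.image f).card ≤ M := by
    obtain ⟨u, -, hu, himg⟩ := Finset.exists_subset_injOn_image_eq_of_surjOn (f := f)
      (S : Set Θ) (S.image f) (by rw [Finset.coe_image]; exact Set.surjOn_image f S)
    rw [← himg, Finset.card_image_of_injOn hu]
    exact hf u hu
  refine (Finset.card_le_mul_card_image S B fun a _ => ?_).trans (Nat.mul_le_mul_left B himg)
  refine hg a _ (fun θ hθ => (Finset.mem_filter.1 hθ).2) fun θ hθ θ' hθ' h => ?_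
  have h1 := Finset.mem_filter.1 (Finset.mem_coe.1 hθ)
  have h2 := Finset.mem_filter.1 (Finset.mem_coe.1 hθ')
  exact hS h1.1 h2.1 (Prod.ext (h1.2.trans h2.2.symm) h)

variable {σ : Type*} {W : ℕ} (a : ℕ → Fin W → Fin W → σ) (b : ℕ → Fin W → σ)

/-- A ReLU network of constant width `W`, whose weights are read off from a parameter vector `θ`
through the index maps `a` and `b`. -/
def paramNet (θ : σ → ℝ) (x : Fin W → ℝ) : ℕ → Fin W → ℝ
  | 0 => x
  | i + 1 => fun j => (∑ k, θ (a i j k) *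
      (if i = 0 then paramNet θ x i k else max (paramNet θ x i k) 0)) + θ (b i j)

open Classical in
/-- The polynomial in the parameters that computes `paramNet` when the active units are those
prescribed by `s`. -/
def paramNetPoly (x : Fin W → ℝ) (s : ℕ → Fin W → Prop) : ℕ → Fin W → MvPolynomial σ ℝ
  | 0 => fun k => MvPolynomial.C (x k)
  | i + 1 => fun j => (∑ k, MvPolynomial.X (a i j k) *
      (if i = 0 ∨ s i k then paramNetPoly x s i k else 0)) + MvPolynomial.X (b i j)

lemma totalDegree_paramNetPoly_le (x : Fin W → ℝ) (s : ℕ → Fin W → Prop) (i : ℕ) (j : Fin W) :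
    (paramNetPoly a b x s i j).totalDegree ≤ i := by
  induction i generalizing j with
  | zero => simp [paramNetPoly]
  | succ i ih =>
    rw [paramNetPoly]
    refine (MvPolynomial.totalDegree_add _ _).trans (max_le ?_ ?_)
    · refine MvPolynomial.totalDegree_finsetSum_le fun k _ => ?_
      refine (MvPolynomial.totalDegree_mul _ _).trans ?_
      rw [MvPolynomial.totalDegree_X, add_comm]
      gcongr
      split_ifs
      · exact ih k
      · simp
    · rw [MvPolynomial.totalDegree_X]
      omega

lemma eval_paramNetPoly (θ : σ → ℝ) (x : Fin W → ℝ) (s : ℕ → Fin W → Prop) (i : ℕ)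
    (hs : ∀ i' < i, ∀ k, s i' k ↔ 0 < paramNet a b θ x i' k) (j : Fin W) :
    MvPolynomial.eval θ (paramNetPoly a b x s i j) = paramNet a b θ x i j := by
  induction i generalizing j with
  | zero => simp [paramNetPoly, paramNet]
  | succ i ih =>
    rw [paramNetPoly, paramNet]
    simp only [map_add, map_sum, map_mul, MvPolynomial.eval_X]
    congr 1
    refine Finset.sum_congr rfl fun k _ => ?_
    congr 1
    have hk := ih (fun i' hi' => hs i' (hi'.trans i.lt_succ_self)) k
    by_cases h0 : i = 0
    · simp only [h0, true_or, if_true] at hk ⊢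
      exact hk
    · rw [if_neg h0]
      by_cases hsk : s i k
      · rw [if_pos (Or.inr hsk), hk, max_eq_left ((hs i i.lt_succ_self k).1 hsk).le]
      · rw [if_neg (not_or.2 ⟨h0, hsk⟩), map_zero, max_eq_right]
        exact not_lt.1 fun h => hsk ((hs i i.lt_succ_self k).2 h)

variable {ι : Type*} (x : ι → Fin W → ℝ)

/-- The units active at the data points `x`, among the first `ℓ` layers. -/
def activationPattern (ℓ : ℕ) (θ : σ → ℝ) (n : ι) (i : ℕ) (k : Fin W) : Prop :=
  i < ℓ ∧ 0 < paramNet a b θ (x n) i k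

lemma eval_paramNetPoly_activationPattern (ℓ : ℕ) (θ : σ → ℝ) (n : ι) (j : Fin W) :
    MvPolynomial.eval θ (paramNetPoly a b (x n) (activationPattern a b x ℓ θ n) ℓ j) =
      paramNet a b θ (x n) ℓ j :=
  eval_paramNetPoly a b θ (x n) _ ℓ (fun _ hi _ => and_iff_right hi) j

variable [Fintype σ] [Fintype ι]

lemma card_le_of_injOn_activationPattern (L ℓ : ℕ) (hℓ : ℓ ≤ L) (S : Finset (σ → ℝ))
    (hS : Set.InjOn (activationPattern a b x ℓ) (S : Set (σ → ℝ))) :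
    S.card ≤ (2 * (Fintype.card ι * W * L) + 1) ^ (Fintype.card σ * ℓ) := by
  induction ℓ generalizing S with
  | zero =>
    rw [mul_zero, pow_zero, Finset.card_le_one]
    exact fun θ hθ θ' hθ' => hS hθ hθ' (by funext n i k; simp [activationPattern])
  | succ ℓ ih =>
    rw [Nat.mul_succ, pow_add, mul_comm]
    refine card_le_mul_of_injOn_prod (activationPattern a b x ℓ)
      (fun θ (nk : ι × Fin W) => 0 < paramNet a b θ (x nk.1) ℓ nk.2) _ _
      (ih (by omega)) (fun s T hT hinj => ?_) S fun θ hθ θ' hθ' h => hS hθ hθ' ?_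
    · have hcard := card_le_of_injOn_sign
        (fun nk : ι × Fin W => paramNetPoly a b (x nk.1) (s nk.1) ℓ nk.2) L
        (fun nk => (totalDegree_paramNetPoly_le a b _ _ _ _).trans (by omega)) T ?_
      · simpa using hcard
      · refine hinj.congr fun θ hθ => funext fun nk => ?_
        rw [← hT θ hθ, eval_paramNetPoly_activationPattern]
    · obtain ⟨h1, h2⟩ := Prod.ext_iff.1 h
      funext n i k
      rcases lt_trichotomy i ℓ with hi | rfl | hi
      · have := congrFun (congrFun (congrFun h1 n) i) k
        simpa [activationPattern, hi, hi.trans ℓ.lt_succ_self] using this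
      · have := congrFun h2 (n, k)
        simpa [activationPattern] using this
      · simp [activationPattern, not_lt.2 (Nat.succ_le_of_lt hi)]

/-- Growth function bound for the subgraphs of ReLU networks. -/
lemma card_le_of_injOn_threshold (L ℓ : ℕ) (hℓ : ℓ ≤ L) (y : ι → ℝ) (j : Fin W)
    (S : Finset (σ → ℝ))
    (hS : Set.InjOn (fun θ n => y n < paramNet a b θ (x n) ℓ j) (S : Set (σ → ℝ))) :
    S.card ≤ (2 * (Fintype.card ι * W * L) + 1) ^ (Fintype.card σ * (L + 1)) := by
  have hW : 0 < W := j.pos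
  have key : S.card ≤ (2 * (Fintype.card ι * W * L) + 1) ^ Fintype.card σ *
      (2 * (Fintype.card ι * W * L) + 1) ^ (Fintype.card σ * ℓ) := by
    refine card_le_mul_of_injOn_prod (activationPattern a b x ℓ)
      (fun θ n => y n < paramNet a b θ (x n) ℓ j) _ _
      (card_le_of_injOn_activationPattern a b x L ℓ hℓ) (fun s T hT hinj => ?_) S
      fun θ hθ θ' hθ' h => hS hθ hθ' (Prod.ext_iff.1 h).2
    have hcard := card_le_of_injOn_sign
      (fun n => paramNetPoly a b (x n) (s n) ℓ j - MvPolynomial.C (y n)) L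
      (fun n => (MvPolynomial.totalDegree_sub_C_le _ _).trans
        ((totalDegree_paramNetPoly_le a b _ _ _ _).trans hℓ)) T ?_
    · refine hcard.trans ?_
      gcongr
      exact Nat.le_mul_of_pos_right _ hW
    · refine hinj.congr fun θ hθ => funext fun n => ?_
      rw [← hT θ hθ, map_sub, eval_paramNetPoly_activationPattern, MvPolynomial.eval_C, sub_pos]
  refine key.trans ?_
  rw [← pow_add]
  refine Nat.pow_le_pow_right (Nat.succ_pos _) ?_
  nlinarith [Nat.mul_le_mul_left (Fintype.card σ) hℓ]

end ParameterizedNetworks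

section Embedding

/-- Extension of a vector by zeros. -/
def zeroPad {d : ℕ} (W : ℕ) (x : Fin d → ℝ) (k : Fin W) : ℝ :=
  if h : (k : ℕ) < d then x ⟨k, h⟩ else 0

/-- Index of a linear weight among the parameters of a width-`W`, depth-`L` network. -/
def weightIndex (W L : ℕ) [NeZero L] (i : ℕ) (j k : Fin W) : Fin L × Fin W × Option (Fin W) :=
  (Fin.ofNat L i, j, some k)

/-- Index of a bias among the parameters of a width-`W`, depth-`L` network. -/
def biasIndex (W L : ℕ) [NeZero L] (i : ℕ) (j : Fin W) : Fin L × Fin W × Option (Fin W) :=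
  (Fin.ofNat L i, j, none)

/-- The weights of a network, padded by zeros. -/
def ReLUNet.params {d : ℕ} (Φ : ReLUNet d) (W L : ℕ) :
    Fin L × Fin W × Option (Fin W) → ℝ
  | (i, j, some k) =>
    if h : (j : ℕ) < Φ.width (i + 1) ∧ (k : ℕ) < Φ.width i then Φ.A i ⟨j, h.1⟩ ⟨k, h.2⟩ else 0
  | (i, j, none) => if h : (j : ℕ) < Φ.width (i + 1) then Φ.b i ⟨j, h⟩ else 0

lemma ReLUNet.paramNet_params {d W L : ℕ} [NeZero L] (Φ : ReLUNet d) (hW : Φ.widthLe W)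
    (hL : Φ.depth ≤ L) (x : Fin d → ℝ) (i : ℕ) (hi : i ≤ Φ.depth) (j : Fin (Φ.width i)) :
    paramNet (weightIndex W L) (biasIndex W L) (Φ.params W L) (zeroPad W x) i
        (Fin.castLE (hW i hi) j) =
      Φ.forward i (fun k => x (Fin.cast Φ.width_in k)) j := by
  induction i with
  | zero =>
    have : (j : ℕ) < d := lt_of_lt_of_eq j.2 Φ.width_in
    simp [paramNet, ReLUNet.forward, zeroPad, this]
    rfl
  | succ i ih =>
    have hiL : i % L = i := Nat.mod_eq_of_lt (by omega)
    rw [paramNet, ReLUNet.forward, ReLUNet.layer]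
    beta_reduce
    congr 1
    · symm
      refine Fintype.sum_of_injective (Fin.castLE (hW i (by omega))) (Fin.castLE_injective _) _ _
        (fun k hk => ?_) fun k => ?_
      · have hk' : ¬ (k : ℕ) < Φ.width i := fun h => hk ⟨⟨k, h⟩, rfl⟩
        simp [weightIndex, ReLUNet.params, hiL, hk']
      · rw [ih (by omega) k]
        congr 1
        simp only [weightIndex, ReLUNet.params]
        have : ∀ i' : ℕ, i' = i → Φ.A i j k =
            if h : ((Fin.castLE (hW (i + 1) hi) j : Fin W) : ℕ) < Φ.width (i' + 1) ∧
              ((Fin.castLE (hW i (by omega)) k : Fin W) : ℕ) < Φ.width i'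
            then Φ.A i' ⟨_, h.1⟩ ⟨_, h.2⟩ else 0 := by
          rintro _ rfl
          simp
        exact this _ hiL
    · simp only [biasIndex, ReLUNet.params]
      have : ∀ i' : ℕ, i' = i →
          (if h : ((Fin.castLE (hW (i + 1) hi) j : Fin W) : ℕ) < Φ.width (i' + 1)
            then Φ.b i' ⟨_, h⟩ else 0) = Φ.b i j := by
        rintro _ rfl
        simp
      exact this _ hiL

lemma exists_paramNet_eq {d W L : ℕ} [NeZero L] [NeZero W] {f : (Fin d → ℝ) → ℝ}
    (hf : f ∈ Rclass d W L) :
    ∃ θ : Fin L × Fin W × Option (Fin W) → ℝ, ∃ ℓ ≤ L, f = fun x =>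
      paramNet (weightIndex W L) (biasIndex W L) θ (zeroPad W x) ℓ 0 := by
  obtain ⟨Φ, hW, hL, rfl⟩ := hf
  refine ⟨Φ.params W L, Φ.depth, hL, funext fun x => ?_⟩
  rw [ReLUNet.realization, ← Φ.paramNet_params hW hL x Φ.depth le_rfl]
  congr 1

lemma measurable_zeroPad (d W : ℕ) :
    Measurable (zeroPad W : (Fin d → ℝ) → Fin W → ℝ) := by
  refine measurable_pi_lambda _ fun k => ?_
  unfold zeroPad
  split_ifs <;> fun_prop

lemma measurable_paramNet {σ : Type*} {W : ℕ} (a : ℕ → Fin W → Fin W → σ) (b : ℕ → Fin W → σ)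
    (θ : σ → ℝ) (i : ℕ) (j : Fin W) : Measurable fun x => paramNet a b θ x i j := by
  induction i generalizing j with
  | zero => exact measurable_pi_apply j
  | succ i ih =>
    simp only [paramNet]
    split_ifs <;> fun_prop

end Embedding

section Separation

lemma exists_card_filter_mem_ge {Z ι : Type*} [MeasurableSpace Z] (Q : Measure Z)
    [IsProbabilityMeasure Q] (A : ι → Set Z) (hA : ∀ p, MeasurableSet (A p)) (δ : ℝ)
    (S : Finset ι) (hS : ∀ p ∈ S, δ ≤ Q.real (A p)) [∀ z p, Decidable (z ∈ A p)] :
    ∃ z, δ * S.card ≤ ((S.filter fun p => z ∈ A p).card : ℝ) := by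
  have hint : ∀ p ∈ S, Integrable ((A p).indicator fun _ => (1 : ℝ)) Q := fun p _ =>
    (integrable_const 1).indicator (hA p)
  obtain ⟨z, hz⟩ := exists_integral_le (integrable_finsetSum S hint)
  refine ⟨z, le_trans ?_ (hz.trans ?_)⟩
  · rw [integral_finsetSum _ hint]
    calc δ * S.card = ∑ _p ∈ S, δ := by simp [mul_comm]
      _ ≤ _ := Finset.sum_le_sum fun p hp => by simpa [integral_indicator, hA p] using hS p hp
  · simp [Set.indicator_apply, Finset.sum_boole]

/-- Greedy selection of `N` points that hit all but a `(1 - δ) ^ N` fraction of the sets. -/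
lemma exists_card_filter_avoid_le {Z ι : Type*} [MeasurableSpace Z] (Q : Measure Z)
    [IsProbabilityMeasure Q] (A : ι → Set Z) (hA : ∀ p, MeasurableSet (A p)) (δ : ℝ)
    (hδ : δ ≤ 1) (S : Finset ι) (hS : ∀ p ∈ S, δ ≤ Q.real (A p))
    [∀ z p, Decidable (z ∈ A p)] (N : ℕ) :
    ∃ z : Fin N → Z, ((S.filter fun p => ∀ n, z n ∉ A p).card : ℝ) ≤ (1 - δ) ^ N * S.card := by
  induction N with
  | zero => exact ⟨Fin.elim0, by simp⟩
  | succ N ih =>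
    obtain ⟨z, hz⟩ := ih
    set S' := S.filter fun p => ∀ n, z n ∉ A p with hS'
    obtain ⟨w, hw⟩ := exists_card_filter_mem_ge Q A hA δ S'
      fun p hp => hS p (Finset.mem_filter.1 hp).1
    refine ⟨Fin.cons w z, ?_⟩
    have heq : (S.filter fun p => ∀ n, (Fin.cons w z : Fin (N + 1) → Z) n ∉ A p) =
        S'.filter fun p => w ∉ A p := by
      ext p
      simp only [hS', Finset.mem_filter, Fin.forall_fin_succ, Fin.cons_zero, Fin.cons_succ]
      tauto
    have hsum : ((S'.filter fun p => w ∈ A p).card : ℝ) + (S'.filter fun p => w ∉ A p).card =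
        S'.card := by
      exact_mod_cast Finset.card_filter_add_card_filter_not (s := S') fun p => w ∈ A p
    rw [heq, pow_succ']
    calc ((S'.filter fun p => w ∉ A p).card : ℝ) ≤ (1 - δ) * S'.card := by linarith
      _ ≤ (1 - δ) * ((1 - δ) ^ N * S.card) :=
        mul_le_mul_of_nonneg_left hz (sub_nonneg.2 hδ)
      _ = _ := by ring

/-- The uniform distribution on `[-1, 1]`. -/
def uniformThreshold : Measure ℝ := (2 : ℝ≥0∞)⁻¹ • volume.restrict (Set.Icc (-1) 1)

instance : IsProbabilityMeasure uniformThreshold := by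
  constructor
  have : ENNReal.ofReal (1 - (-1)) = 2 := by norm_num
  simp only [uniformThreshold, Measure.smul_apply, Measure.restrict_apply_univ, Real.volume_Icc,
    this, smul_eq_mul]
  exact ENNReal.inv_mul_cancel (by simp) (by simp)

variable {X : Type*} [MeasurableSpace X]

/-- The points between the graphs of `f` and `g`. -/
def separatingSet (f g : X → ℝ) : Set (X × ℝ) := {z | ¬ (z.2 < f z.1 ↔ z.2 < g z.1)}

lemma measurableSet_separatingSet {f g : X → ℝ} (hf : Measurable f) (hg : Measurable g) :
    MeasurableSet (separatingSet f g) := by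
  have h : ∀ {f : X → ℝ}, Measurable f → MeasurableSet {z : X × ℝ | z.2 < f z.1} :=
    fun hf => measurableSet_lt measurable_snd (hf.comp measurable_fst)
  have : separatingSet f g = symmDiff {z : X × ℝ | z.2 < f z.1} {z : X × ℝ | z.2 < g z.1} := by
    ext z
    simp only [separatingSet, Set.mem_symmDiff, Set.mem_ofPred_eq]
    tauto
  rw [this]
  exact (h hf).symmDiff (h hg)

lemma uniformThreshold_separating_ge {s t : ℝ} (hs : s ∈ Set.Icc (-1 : ℝ) 1)
    (ht : t ∈ Set.Icc (-1 : ℝ) 1) :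
    2⁻¹ * ‖s - t‖ₑ ≤ uniformThreshold {y | ¬ (y < s ↔ y < t)} := by
  wlog h : s ≤ t generalizing s t
  · have := this ht hs (le_of_not_ge h)
    rw [← enorm_neg, neg_sub] at this
    simpa only [iff_comm] using this
  have hsub : Set.Ico s t ⊆ {y | ¬ (y < s ↔ y < t)} := fun y hy =>
    fun h => absurd (h.2 hy.2) (not_lt.2 hy.1)
  refine le_trans ?_ (measure_mono hsub)
  have hI : Set.Ico s t ∩ Set.Icc (-1) 1 = Set.Ico s t :=
    Set.inter_eq_left.2 fun y hy => ⟨hs.1.trans hy.1, hy.2.le.trans ht.2⟩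
  rw [uniformThreshold, Measure.smul_apply, Measure.restrict_apply measurableSet_Ico, hI,
    Real.volume_Ico, smul_eq_mul, Real.enorm_eq_ofReal_abs, abs_of_nonpos (sub_nonpos.2 h),
    neg_sub]

lemma separatingSet_measure_ge (P : Measure X) [IsProbabilityMeasure P] {f g : X → ℝ}
    (hf : Measurable f) (hg : Measurable g) (hf1 : ∀ x, f x ∈ Set.Icc (-1 : ℝ) 1)
    (hg1 : ∀ x, g x ∈ Set.Icc (-1 : ℝ) 1) (ε : ℝ) (hε : 0 < ε)
    (hd : ENNReal.ofReal ε < L2dist P f g) :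
    ε ^ 2 / 4 ≤ (P.prod uniformThreshold).real (separatingSet f g) := by
  have hle : ∫⁻ x, 2⁻¹ * ‖f x - g x‖ₑ ∂P ≤ (P.prod uniformThreshold) (separatingSet f g) := by
    rw [Measure.prod_apply (measurableSet_separatingSet hf hg)]
    exact lintegral_mono fun x => uniformThreshold_separating_ge (hf1 x) (hg1 x)
  have hsq : L2dist P f g ^ 2 ≤ 4 * ∫⁻ x, 2⁻¹ * ‖f x - g x‖ₑ ∂P := by
    have h2 := eLpNorm_nnreal_pow_eq_lintegral (f := f - g) (μ := P) (p := 2) two_ne_zero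
    have h2' : L2dist P f g ^ 2 = ∫⁻ x, ‖f x - g x‖ₑ ^ 2 ∂P := by
      simpa [L2dist] using h2
    rw [h2', ← lintegral_const_mul' _ _ (by simp)]
    refine lintegral_mono fun x => ?_
    have hb : ‖f x - g x‖ₑ ≤ 2 := by
      rw [Real.enorm_eq_ofReal_abs, ← ENNReal.ofReal_ofNat 2]
      refine ENNReal.ofReal_le_ofReal (abs_le.2 ?_)
      have := hf1 x
      have := hg1 x
      simp only [Set.mem_Icc] at *
      constructor <;> linarith
    have h4 : (4 : ℝ≥0∞) * (2⁻¹ * ‖f x - g x‖ₑ) = 2 * ‖f x - g x‖ₑ := by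
      rw [← mul_assoc]
      congr 1
      rw [show (4 : ℝ≥0∞) = 2 * 2 by norm_num, mul_assoc,
        ENNReal.mul_inv_cancel two_ne_zero (by simp), mul_one]
    rw [h4, sq]
    gcongr
  have h : ENNReal.ofReal ε ^ 2 ≤ 4 * (P.prod uniformThreshold) (separatingSet f g) :=
    (pow_le_pow_left' hd.le 2).trans (hsq.trans (by gcongr))
  have h' := ENNReal.toReal_mono (ENNReal.mul_ne_top (by simp) (measure_ne_top _ _)) h
  rw [ENNReal.toReal_pow, ENNReal.toReal_ofReal hε.le, ENNReal.toReal_mul] at h'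
  simp only [ENNReal.toReal_ofNat] at h'
  rw [measureReal_def]
  linarith

/-- An `L²`-separated family of bounded functions is separated by the subgraphs at few points. -/
lemma exists_injOn_threshold (P : Measure X) [IsProbabilityMeasure P] (F : Finset (X → ℝ))
    (hF : ∀ f ∈ F, Measurable f) (hF1 : ∀ f ∈ F, ∀ x, f x ∈ Set.Icc (-1 : ℝ) 1) (ε : ℝ)
    (hε : 0 < ε) (hε1 : ε ≤ 1)
    (hd : ∀ f ∈ F, ∀ g ∈ F, f ≠ g → ENNReal.ofReal ε < L2dist P f g) (N : ℕ)
    (hN : (1 - ε ^ 2 / 4) ^ N * (F.card : ℝ) ^ 2 < 1) :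
    ∃ z : Fin N → X × ℝ,
      Set.InjOn (fun (f : X → ℝ) n => (z n).2 < f (z n).1) (F : Set (X → ℝ)) := by
  classical
  set S : Finset (F × F) := Finset.univ.filter fun p => p.1 ≠ p.2 with hS
  obtain ⟨z, hz⟩ := exists_card_filter_avoid_le (P.prod uniformThreshold)
    (fun p : F × F => separatingSet p.1.1 p.2.1)
    (fun p => measurableSet_separatingSet (hF _ p.1.2) (hF _ p.2.2)) (ε ^ 2 / 4) (by nlinarith)
    S (fun p hp => separatingSet_measure_ge P (hF _ p.1.2) (hF _ p.2.2) (hF1 _ p.1.2)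
      (hF1 _ p.2.2) ε hε (hd _ p.1.2 _ p.2.2 fun h => (Finset.mem_filter.1 hp).2 (Subtype.ext h)))
    N
  refine ⟨z, fun f hf g hg hfg => ?_⟩
  by_contra hne
  have hmem : ((⟨f, hf⟩, ⟨g, hg⟩) : F × F) ∈
      S.filter fun p => ∀ n, z n ∉ separatingSet p.1.1 p.2.1 := by
    simp only [hS, Finset.mem_filter, Finset.mem_univ, true_and]
    exact ⟨fun h => hne (congrArg Subtype.val h), fun n h => h (iff_of_eq (congrFun hfg n))⟩
  have h1 : (1 : ℝ) ≤ (S.filter fun p => ∀ n, z n ∉ separatingSet p.1.1 p.2.1).card := by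
    exact_mod_cast Finset.card_pos.2 ⟨_, hmem⟩
  have h2 : (S.card : ℝ) ≤ (F.card : ℝ) ^ 2 := by
    have : S.card ≤ F.card * F.card := (Finset.card_filter_le _ _).trans (by simp)
    rw [sq]
    exact_mod_cast this
  have h3 : (0 : ℝ) ≤ (1 - ε ^ 2 / 4) ^ N := pow_nonneg (by nlinarith) N
  have := mul_le_mul_of_nonneg_left h2 h3
  linarith

end Separation

section Covering

/-- If packings are bounded, some packing is at the same time a covering. -/
lemma exists_packing_coveringNumber_le {α : Type*} (ε : ℝ≥0∞) (X : Set α) (δ : α → α → ℝ≥0∞)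
    (hself : ∀ x, δ x x ≤ ε) (hsymm : ∀ x y, δ x y = δ y x) (K : ℕ)
    (hK : ∀ C : Finset α, (C : Set α) ⊆ X → (∀ x ∈ C, ∀ y ∈ C, x ≠ y → ε < δ x y) → C.card ≤ K) :
    ∃ C : Finset α, (C : Set α) ⊆ X ∧ (∀ x ∈ C, ∀ y ∈ C, x ≠ y → ε < δ x y) ∧
      coveringNumber ε X δ ≤ C.card := by
  classical
  set s : Set ℕ := {n | ∃ C : Finset α, (C : Set α) ⊆ X ∧
    (∀ x ∈ C, ∀ y ∈ C, x ≠ y → ε < δ x y) ∧ C.card = n} with hs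
  have hbdd : BddAbove s := ⟨K, by rintro _ ⟨C, h1, h2, rfl⟩; exact hK C h1 h2⟩
  have hne : s.Nonempty := ⟨0, ∅, by simp, by simp, rfl⟩
  obtain ⟨C, hCX, hC, hcard⟩ := Nat.sSup_mem hne hbdd
  refine ⟨C, hCX, hC, sInf_le ⟨C, hCX, fun x hx => ?_, rfl⟩⟩
  by_contra! hcon
  have hxC : x ∉ C := fun h => absurd (hcon x h) (not_lt.2 (hself x))
  have hmem : C.card + 1 ∈ s := by
    refine ⟨insert x C, ?_, ?_, Finset.card_insert_of_notMem hxC⟩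
    · rw [Finset.coe_insert]
      exact Set.insert_subset hx hCX
    · intro y hy z hz hyz
      rcases Finset.mem_insert.1 hy with rfl | hyC <;> rcases Finset.mem_insert.1 hz with rfl | hzC
      · exact absurd rfl hyz
      · exact hcon z hzC
      · rw [hsymm]
        exact hcon y hyC
      · exact hC y hyC z hzC hyz
  have := le_csSup hbdd hmem
  omega

lemma elog2_le_ofReal_logb {n : ℕ∞} {m : ℕ} (h : n ≤ m) :
    elog2 n ≤ ENNReal.ofReal (Real.logb 2 m) := by
  lift n to ℕ using (h.trans_lt (ENat.natCast_lt_top m)).ne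
  rw [elog2, if_neg (ENat.natCast_ne_top n), ENat.toNat_natCast]
  rcases Nat.eq_zero_or_pos n with rfl | hn
  · simp
  · refine ENNReal.ofReal_le_ofReal (Real.logb_le_logb_of_le one_lt_two ?_ ?_)
    · exact_mod_cast hn
    · exact_mod_cast h

end Covering

section Numerics

lemma le_of_le_log_mul {v c : ℝ} (hv : 0 < v) (hc : 0 < c) (h : v ≤ Real.log (c * v)) :
    v ≤ 2 * Real.log c := by
  have h1 := Real.log_le_sub_one_of_pos (half_pos hv)
  rw [Real.log_div hv.ne' two_ne_zero] at h1
  rw [Real.log_mul hc.ne' hv.ne'] at h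
  have := Real.log_two_lt_d9
  linarith

lemma log_le_of_le_pow {u T ε N : ℝ} (hT : 4 ≤ T) (hε : 0 < ε) (hε2 : ε < 1 / 2) (hu : 0 < u)
    (hN : N ≤ 8 * u / ε ^ 2 + 2) (hN1 : 1 ≤ N) (h : u ≤ 4 * T ^ 2 * Real.log (3 * (N * T))) :
    u ≤ 112 * T ^ 2 * (Real.logb 2 T * Real.logb 2 ε⁻¹) := by
  have hlog2 : 0 < Real.log 2 := Real.log_pos one_lt_two
  have hlog21 : Real.log 2 ≤ 1 := by linarith [Real.log_two_lt_d9]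
  have hlogT : 0 < Real.log T := Real.log_pos (by linarith)
  have hεinv : 2 ≤ ε⁻¹ := by
    rw [le_inv_comm₀ two_pos hε]
    linarith
  have hlogε : 0 < Real.log ε⁻¹ := Real.log_pos (by linarith)
  set A := Real.logb 2 T with hA
  set B := Real.logb 2 ε⁻¹ with hB
  have hA2 : 2 ≤ A := by
    rw [hA, Real.le_logb_iff_rpow_le one_lt_two (by linarith)]
    norm_num
    exact hT
  have hB1 : 1 ≤ B := by
    rw [hB, Real.le_logb_iff_rpow_le one_lt_two (by linarith)]
    simpa using hεinv
  have hTA : Real.log T ≤ A := le_div_self hlogT.le hlog2 hlog21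
  have hεB : Real.log ε⁻¹ ≤ B := le_div_self hlogε.le hlog2 hlog21
  have hT2 : 0 < T ^ 2 := by positivity
  set v := u / (4 * T ^ 2) with hv
  have huv : u = 4 * T ^ 2 * v := by rw [hv]; field_simp
  have hv0 : 0 < v := by positivity
  have hvle : v ≤ Real.log (3 * (N * T)) := by
    rw [hv, div_le_iff₀ (by positivity)]
    linarith
  suffices hfin : v ≤ 28 * (A * B) by
    rw [huv]
    nlinarith
  rcases le_total v 1 with hv1 | hv1
  · nlinarith
  · have hNle : 3 * (N * T) ≤ (T ^ 7 * ε⁻¹ ^ 2) * v := by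
      have hεsq : 1 ≤ ε⁻¹ ^ 2 := one_le_pow₀ (by linarith)
      have h1 : N ≤ 34 * (T ^ 2 * ε⁻¹ ^ 2 * v) := by
        have : 1 ≤ T ^ 2 * ε⁻¹ ^ 2 * v :=
          one_le_mul_of_one_le_of_one_le (one_le_mul_of_one_le_of_one_le (by nlinarith) hεsq) hv1
        have h2 : 8 * u / ε ^ 2 = 32 * (T ^ 2 * ε⁻¹ ^ 2 * v) := by
          rw [huv, inv_pow]
          field_simp
          ring
        linarith
      have hT4 : 102 ≤ T ^ 4 := by
        calc (102 : ℝ) ≤ 4 ^ 4 := by norm_num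
          _ ≤ T ^ 4 := by gcongr
      calc 3 * (N * T) ≤ 3 * (34 * (T ^ 2 * ε⁻¹ ^ 2 * v) * T) := by gcongr
        _ = 102 * (T ^ 3 * ε⁻¹ ^ 2 * v) := by ring
        _ ≤ T ^ 4 * (T ^ 3 * ε⁻¹ ^ 2 * v) := by gcongr
        _ = _ := by ring
    have hle := le_of_le_log_mul hv0 (by positivity)
      (hvle.trans (Real.log_le_log (by positivity) hNle))
    rw [Real.log_mul (by positivity) (by positivity), Real.log_pow, Real.log_pow] at hle
    push_cast at hle
    nlinarith

/-- Solving the implicit cardinality bound that results from the growth function estimate. -/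
lemma logb_card_le {W L M : ℕ} (hW : 2 ≤ W) (hL : 2 ≤ L) {ε : ℝ} (hε : 0 < ε) (hε2 : ε < 1 / 2)
    (h : ∀ N : ℕ, (1 - ε ^ 2 / 4) ^ N * (M : ℝ) ^ 2 < 1 →
      M ≤ (L + 1) * (2 * (N * W * L) + 1) ^ (L * (W * (W + 1)) * (L + 1))) :
    Real.logb 2 M ≤ 224 * ((W : ℝ) ^ 2 * (L : ℝ) ^ 2) * Real.logb 2 ((W : ℝ) * (L : ℝ)) *
      Real.logb 2 ε⁻¹ := by
  have hWr : (2 : ℝ) ≤ W := by exact_mod_cast hW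
  have hLr : (2 : ℝ) ≤ L := by exact_mod_cast hL
  have hT : (4 : ℝ) ≤ (W : ℝ) * L := by nlinarith
  have hA : 0 ≤ Real.logb 2 ((W : ℝ) * L) := Real.logb_nonneg one_lt_two (by linarith)
  have hB : 0 ≤ Real.logb 2 ε⁻¹ := Real.logb_nonneg one_lt_two
    ((one_le_inv₀ hε).2 (by linarith))
  rcases Nat.lt_or_ge M 2 with hM | hM
  · have : Real.logb 2 M = 0 := by interval_cases M <;> simp
    rw [this]
    positivity
  have hMr : (2 : ℝ) ≤ M := by exact_mod_cast hM
  set u := Real.log M with hu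
  have hu0 : 0 < u := Real.log_pos (by linarith)
  set N := ⌈8 * u / ε ^ 2⌉₊ + 1 with hN
  have hNgt : 8 * u / ε ^ 2 < N := by
    rw [hN]
    push_cast
    linarith [Nat.le_ceil (8 * u / ε ^ 2)]
  have hNle : (N : ℝ) ≤ 8 * u / ε ^ 2 + 2 := by
    rw [hN]
    push_cast
    linarith [Nat.ceil_lt_add_one (show 0 ≤ 8 * u / ε ^ 2 by positivity)]
  have hN1 : 1 ≤ N := by omega
  have hN1r : (1 : ℝ) ≤ N := by exact_mod_cast hN1
  have hsmall : (1 - ε ^ 2 / 4) ^ N * (M : ℝ) ^ 2 < 1 := by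
    have h1 : (1 - ε ^ 2 / 4) ^ N ≤ Real.exp (-(ε ^ 2 / 4) * N) := by
      rw [mul_comm, Real.exp_nat_mul]
      refine pow_le_pow_left₀ (by nlinarith) ?_ N
      linarith [Real.add_one_le_exp (-(ε ^ 2 / 4))]
    have h2 : (M : ℝ) ^ 2 = Real.exp (2 * u) := by
      rw [two_mul, Real.exp_add, hu, Real.exp_log (by linarith), sq]
    calc (1 - ε ^ 2 / 4) ^ N * (M : ℝ) ^ 2
        ≤ Real.exp (-(ε ^ 2 / 4) * N) * Real.exp (2 * u) := by rw [h2]; gcongr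
      _ = Real.exp (-(ε ^ 2 / 4) * N + 2 * u) := (Real.exp_add _ _).symm
      _ < 1 := by
        rw [Real.exp_lt_one_iff]
        rw [div_lt_iff₀ (by positivity)] at hNgt
        linarith
  have hMle := h N hsmall
  have hexp : L * (W * (W + 1)) * (L + 1) + 1 ≤ 4 * (W * L) ^ 2 := by
    have h1 : 2 * (W + 1) ≤ 3 * W := by omega
    have h2 : 2 * (L + 1) ≤ 3 * L := by omega
    have h3 := Nat.mul_le_mul h1 h2
    have h4 := Nat.mul_le_mul_left (W * L) h3
    have h5 : 4 ≤ W * L := by nlinarith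
    nlinarith
  have hMle' : M ≤ (3 * (N * (W * L))) ^ (4 * (W * L) ^ 2) := by
    have hLN : L ≤ N * (W * L) := by
      calc L = 1 * (1 * L) := by ring
        _ ≤ N * (W * L) := by gcongr; omega
    have h1N : 1 ≤ N * (W * L) := by omega
    calc M ≤ (L + 1) * (2 * (N * W * L) + 1) ^ (L * (W * (W + 1)) * (L + 1)) := hMle
      _ ≤ (3 * (N * (W * L))) * (3 * (N * (W * L))) ^ (L * (W * (W + 1)) * (L + 1)) := by
        gcongr
        · omega
        · rw [mul_assoc N W L]
          omega
      _ = (3 * (N * (W * L))) ^ (L * (W * (W + 1)) * (L + 1) + 1) := (pow_succ' _ _).symm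
      _ ≤ _ := Nat.pow_le_pow_right (by omega) hexp
  have hule : u ≤ 4 * ((W : ℝ) * L) ^ 2 * Real.log (3 * (N * ((W : ℝ) * L))) := by
    have : (M : ℝ) ≤ (3 * (N * ((W : ℝ) * L))) ^ (4 * (W * L) ^ 2) := by exact_mod_cast hMle'
    have := Real.log_le_log (by linarith) this
    rw [Real.log_pow] at this
    push_cast at this
    exact this
  have hfin := log_le_of_le_pow hT hε hε2 hu0 hNle hN1r hule
  have hlog2 : 1 / 2 ≤ Real.log 2 := by linarith [Real.log_two_gt_d9]
  have : Real.logb 2 M ≤ 2 * u := by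
    rw [Real.logb, div_le_iff₀ (by linarith)]
    nlinarith
  calc Real.logb 2 M ≤ 2 * u := this
    _ ≤ 2 * (112 * ((W : ℝ) * L) ^ 2 *
        (Real.logb 2 ((W : ℝ) * L) * Real.logb 2 ε⁻¹)) := by linarith
    _ = _ := by ring

end Numerics

section Packing

lemma trunc_one_mem_Icc (t : ℝ) : trunc 1 t ∈ Set.Icc (-1 : ℝ) 1 :=
  ⟨le_max_left _ _, max_le (by norm_num) (min_le_left _ _)⟩

lemma lt_trunc_one_iff (y t : ℝ) : y < trunc 1 t ↔ y < -1 ∨ y < 1 ∧ y < t := by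
  rw [trunc, lt_max_iff, lt_min_iff]

lemma card_packing_le {d W L : ℕ} [NeZero L] [NeZero W] (P : Measure (Fin d → ℝ))
    [IsProbabilityMeasure P] {ε : ℝ} (hε : 0 < ε) (hε1 : ε ≤ 1)
    (C : Finset ((Fin d → ℝ) → ℝ))
    (hCX : (C : Set ((Fin d → ℝ) → ℝ)) ⊆ truncClass 1 (Rclass d W L))
    (hC : ∀ f ∈ C, ∀ g ∈ C, f ≠ g → ENNReal.ofReal ε < L2dist P f g) (N : ℕ)
    (hN : (1 - ε ^ 2 / 4) ^ N * (C.card : ℝ) ^ 2 < 1) :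
    C.card ≤ (L + 1) * (2 * (N * W * L) + 1) ^ (L * (W * (W + 1)) * (L + 1)) := by
  classical
  have hrep : ∀ f : (Fin d → ℝ) → ℝ, ∃ θ : Fin L × Fin W × Option (Fin W) → ℝ, ∃ ℓ : ℕ,
      f ∈ C → ℓ ≤ L ∧ f = fun x => trunc 1
        (paramNet (weightIndex W L) (biasIndex W L) θ (zeroPad W x) ℓ 0) := by
    intro f
    by_cases hf : f ∈ C
    · obtain ⟨g, hg, rfl⟩ := hCX hf
      obtain ⟨θ, ℓ, hℓ, rfl⟩ := exists_paramNet_eq hg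
      exact ⟨θ, ℓ, fun _ => ⟨hℓ, rfl⟩⟩
    · exact ⟨0, 0, fun h => absurd h hf⟩
  choose θ ℓ hθ using hrep
  obtain ⟨z, hz⟩ := exists_injOn_threshold P C
    (fun f hf => by
      rw [(hθ f hf).2]
      unfold trunc
      exact measurable_const.max (measurable_const.min
        ((measurable_paramNet _ _ _ _ _).comp (measurable_zeroPad d W))))
    (fun f hf x => by
      rw [(hθ f hf).2]
      exact trunc_one_mem_Icc _) ε hε hε1 hC N hN
  have hmaps : ∀ f ∈ C, ℓ f ∈ Finset.range (L + 1) := fun f hf =>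
    Finset.mem_range.2 (Nat.lt_succ_of_le (hθ f hf).1)
  have hcard := Finset.card_le_mul_card_image_of_maps_to hmaps
    ((2 * (N * W * L) + 1) ^ (L * (W * (W + 1)) * (L + 1))) fun l hl => ?_
  · rwa [Finset.card_range, mul_comm] at hcard
  set T := C.filter fun f => ℓ f = l with hT
  have hmem : ∀ f ∈ T, f ∈ C ∧ ℓ f = l := fun f hf => Finset.mem_filter.1 hf
  have hinj : ∀ f ∈ T, ∀ g ∈ T,
      (∀ n, (z n).2 < paramNet (weightIndex W L) (biasIndex W L) (θ f)
          (zeroPad W (z n).1) l 0 ↔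
        (z n).2 < paramNet (weightIndex W L) (biasIndex W L) (θ g)
          (zeroPad W (z n).1) l 0) → f = g := by
    intro f hf g hg h
    obtain ⟨hfC, hfl⟩ := hmem f hf
    obtain ⟨hgC, hgl⟩ := hmem g hg
    refine hz hfC hgC (funext fun n => propext ?_)
    beta_reduce
    rw [(hθ f hfC).2, (hθ g hgC).2, hfl, hgl]
    simp only [lt_trunc_one_iff, h n]
  have hθinj : Set.InjOn θ (T : Set ((Fin d → ℝ) → ℝ)) := fun f hf g hg h =>
    hinj f hf g hg fun n => by rw [h]
  rw [← Finset.card_image_of_injOn hθinj]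
  have := card_le_of_injOn_threshold (weightIndex W L) (biasIndex W L)
    (fun n => zeroPad W (z n).1) L l (Nat.lt_succ_iff.1 (Finset.mem_range.1 hl))
    (fun n => (z n).2) 0 (T.image θ) ?_
  · simpa using this
  · intro t ht t' ht' h
    obtain ⟨f, hf, rfl⟩ := Finset.mem_image.1 (Finset.mem_coe.1 ht)
    obtain ⟨g, hg, rfl⟩ := Finset.mem_image.1 (Finset.mem_coe.1 ht')
    rw [hinj f hf g hg fun n => iff_of_eq (congrFun h n)]

end Packing

/-- Covering number upper bound for fully-connected ReLU networks with
unconstrained weights and truncated output, with respect to `L²(P)` for an arbitrary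
probability distribution `P` on `ℝ^d`. -/
theorem covering_upper_bound_truncated_networks :
    ∃ C : ℝ, 0 < C ∧
      ∀ (d W L : ℕ) (P : Measure (Fin d → ℝ)) (ε : ℝ),
        0 < d → d ≤ W → 2 ≤ W → 2 ≤ L → IsProbabilityMeasure P →
        0 < ε → ε < 1 / 2 →
        elog2 (coveringNumber (ENNReal.ofReal ε) (truncClass 1 (Rclass d W L)) (L2dist P))
          ≤ ENNReal.ofReal
              (C * ((W : ℝ) ^ 2 * (L : ℝ) ^ 2) * Real.logb 2 ((W : ℝ) * (L : ℝ)) *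
                Real.logb 2 ε⁻¹) := by
  refine ⟨224, by norm_num, fun d W L P ε _ _ hW hL hP hε hε2 => ?_⟩
  have : NeZero W := ⟨by omega⟩
  have : NeZero L := ⟨by omega⟩
  set R := 224 * ((W : ℝ) ^ 2 * (L : ℝ) ^ 2) * Real.logb 2 ((W : ℝ) * (L : ℝ)) *
    Real.logb 2 ε⁻¹ with hR
  have hpack : ∀ C : Finset ((Fin d → ℝ) → ℝ),
      (C : Set ((Fin d → ℝ) → ℝ)) ⊆ truncClass 1 (Rclass d W L) →
      (∀ f ∈ C, ∀ g ∈ C, f ≠ g → ENNReal.ofReal ε < L2dist P f g) →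
      Real.logb 2 C.card ≤ R := fun C hCX hC =>
    logb_card_le hW hL hε hε2 fun N hN => card_packing_le P hε (by linarith) C hCX hC N hN
  obtain ⟨C, hCX, hC, hcov⟩ := exists_packing_coveringNumber_le (ENNReal.ofReal ε)
    (truncClass 1 (Rclass d W L)) (L2dist P) (fun f => by simp [L2dist])
    (fun f g => eLpNorm_sub_comm f g 2 P) ⌊(2 : ℝ) ^ R⌋₊ fun C hCX hC => by
      rcases Nat.eq_zero_or_pos C.card with h0 | hpos
      · rw [h0]
        exact Nat.zero_le _
      · refine Nat.le_floor ?_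
        rw [← Real.logb_le_iff_le_rpow one_lt_two (by exact_mod_cast hpos)]
        exact hpack C hCX hC
  exact (elog2_le_ofReal_logb hcov).trans (ENNReal.ofReal_le_ofReal (hpack C hCX hC))
end
end

section
/- There exists an absolute constant C ∈ ℝ_+ such that for all W, L ∈ ℕ with W, L ≥ 2, the minimax error in approximating 1-Lipschitz functions bounded by 1 through ReLU networks with unconstrained weight magnitude satisfies A(H^1([0,1]), R(1,W,L), ‖·‖_{L²([0,1])}) ≥ min{ 1/8, C · (W²L² (log(WL))²)^{−1} }. -/
open MeasureTheory ProbabilityTheory ENNReal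

noncomputable section

/-- `H¹([0,1])`: continuous functions on `[0,1]` bounded by 1 and 1-Lipschitz. -/
def H1 : Set (ℝ → ℝ) :=
  {f | ContinuousOn f (Set.Icc 0 1) ∧ (∀ x ∈ Set.Icc (0 : ℝ) 1, |f x| ≤ 1) ∧
    ∀ x ∈ Set.Icc (0 : ℝ) 1, ∀ y ∈ Set.Icc (0 : ℝ) 1, |f x - f y| ≤ |x - y|}

/-- View a function on `ℝ^1` as a function of one real variable. -/
def toOneVar (g : (Fin 1 → ℝ) → ℝ) : ℝ → ℝ := fun t => g fun _ => t

/-- `R(1,W,L,B)` viewed as a set of functions of one real variable. -/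
def RclassB₁ (W L : ℕ) (B : ℝ) : Set (ℝ → ℝ) := toOneVar '' RclassB 1 W L B

/-- `R(1,W,L)` (no weight-magnitude constraint) viewed as a set of functions of
one real variable. -/
def Rclass₁ (W L : ℕ) : Set (ℝ → ℝ) := toOneVar '' Rclass 1 W L

namespace MvPolynomial

theorem totalDegree_pderiv_le {σ R : Type*} [CommSemiring R] (i : σ) (p : MvPolynomial σ R) :
    (pderiv i p).totalDegree ≤ p.totalDegree := by
  classical
  refine Finset.sup_le fun m hm => ?_
  have h : m + Finsupp.single i 1 ∈ p.support := by
    rw [mem_support_iff, coeff_pderiv] at hm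
    rw [mem_support_iff]
    exact left_ne_zero_of_mul hm
  refine le_trans ?_ (le_totalDegree h)
  rw [Finsupp.sum_add_index' (fun _ => rfl) (fun _ _ _ => rfl)]
  exact Nat.le_add_right _ _

theorem hasDerivAt_eval_update {ι : Type*} [DecidableEq ι] (p : MvPolynomial ι ℝ) (x : ι → ℝ)
    (i : ι) (t : ℝ) :
    HasDerivAt (fun t => eval (Function.update x i t) p)
      (eval (Function.update x i t) (pderiv i p)) t := by
  induction p using MvPolynomial.induction_on with
  | C a => simpa using hasDerivAt_const t a
  | add p q hp hq =>
    simp only [map_add]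
    exact hp.add hq
  | mul_X p j hp =>
    have hX : HasDerivAt (fun t => Function.update x i t j)
        (eval (Function.update x i t) (pderiv i (X j : MvPolynomial ι ℝ))) t := by
      by_cases hj : j = i
      · subst hj
        simp only [Function.update_self, pderiv_X_self, map_one]
        exact hasDerivAt_id t
      · simpa [pderiv_X_of_ne hj, Function.update_of_ne hj] using hasDerivAt_const t (x j)
    have := hp.mul hX
    simp only [pderiv_mul, map_add, map_mul, eval_X] at this ⊢
    exact this

theorem eval_pderiv_eq_zero_of_isLocalMax {ι : Type*} [Fintype ι] {p : MvPolynomial ι ℝ}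
    {x : ι → ℝ} (h : IsLocalMax (fun y => eval y p) x) (i : ι) : eval x (pderiv i p) = 0 := by
  classical
  have hd := hasDerivAt_eval_update p x i (x i)
  rw [Function.update_eq_self] at hd
  refine IsLocalMax.hasDerivAt_eq_zero ?_ hd
  have hc : Filter.Tendsto (Function.update x i) (nhds (x i)) (nhds x) := by
    have : Continuous (Function.update x i) := continuous_const.update i continuous_id
    simpa using this.tendsto (x i)
  have := hc.eventually h
  simpa [IsLocalMax, IsMaxFilter] using this

/-- A real polynomial grows at most like the power of the sup norm given by its degree. -/
theorem exists_abs_eval_le {ι : Type*} [Fintype ι] (p : MvPolynomial ι ℝ) :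
    ∃ A : ℝ, ∀ x : ι → ℝ, |eval x p| ≤ A * max 1 ‖x‖ ^ p.totalDegree := by
  refine ⟨∑ m ∈ p.support, |coeff m p|, fun x => ?_⟩
  rw [eval_eq', Finset.sum_mul]
  refine (Finset.abs_sum_le_sum_abs _ _).trans (Finset.sum_le_sum fun m hm => ?_)
  rw [abs_mul]
  refine mul_le_mul_of_nonneg_left ?_ (abs_nonneg _)
  have h1 : (1 : ℝ) ≤ max 1 ‖x‖ := le_max_left _ _
  rw [Finset.abs_prod]
  calc ∏ i, |x i ^ m i| ≤ ∏ i, max 1 ‖x‖ ^ m i := by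
        refine Finset.prod_le_prod (fun _ _ => abs_nonneg _) fun i _ => ?_
        rw [abs_pow]
        exact pow_le_pow_left₀ (abs_nonneg _) ((norm_le_pi_norm x i).trans (le_max_right _ _)) _
    _ = max 1 ‖x‖ ^ (∑ i, m i) := Finset.prod_pow_eq_pow_sum _ _ _
    _ ≤ _ := by
        refine pow_le_pow_right₀ h1 ?_
        have := le_totalDegree hm
        rwa [Finsupp.sum_fintype _ _ (fun _ => rfl)] at this

/-- An elementary Bézout bound: a finite set on which every `D`-th power of a coordinate agrees
with a polynomial of degree less than `D` has at most `D ^ n` points. -/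
theorem card_le_pow_of_forall_pow_eq_eval {ι : Type*} [Fintype ι] {D : ℕ}
    (r : ι → MvPolynomial ι ℝ) (hr : ∀ i, (r i).totalDegree < D) (T : Finset (ι → ℝ))
    (hT : ∀ x ∈ T, ∀ i, x i ^ D = eval x (r i)) : T.card ≤ D ^ Fintype.card ι := by
  classical
  let restr : MvPolynomial ι ℝ →ₗ[ℝ] (T → ℝ) :=
    LinearMap.pi fun x => (aeval (x : ι → ℝ)).toLinearMap
  have restr_apply (p : MvPolynomial ι ℝ) (x : T) : restr p x = eval (x : ι → ℝ) p := by
    change aeval (x : ι → ℝ) p = _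
    exact DFunLike.congr_fun (coe_aeval_eq_eval _) p
  let mon : (ι → Fin D) → (T → ℝ) := fun e x => ∏ i, (x : ι → ℝ) i ^ (e i : ℕ)
  have key : ∀ n : ℕ, ∀ p : MvPolynomial ι ℝ, p.totalDegree ≤ n →
      restr p ∈ Submodule.span ℝ (Set.range mon) := by
    intro n
    induction n using Nat.strong_induction_on with
    | _ n ih =>
    intro p hp
    rw [p.as_sum, map_sum]
    refine Submodule.sum_mem _ fun m hm => ?_
    have hmn : ∑ i, m i ≤ n := by
      have := (le_totalDegree hm).trans hp
      rwa [Finsupp.sum_fintype _ _ (fun _ => rfl)] at this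
    have hfac : (monomial m (coeff m p)) = (coeff m p) • (monomial m (1 : ℝ)) := by
      rw [smul_monomial, smul_eq_mul, mul_one]
    rw [hfac, map_smul]
    refine Submodule.smul_mem _ _ ?_
    by_cases h : ∀ i, m i < D
    · refine Submodule.subset_span ⟨fun i => ⟨m i, h i⟩, ?_⟩
      funext x
      rw [restr_apply, eval_monomial, one_mul, Finsupp.prod_fintype _ _ (by simp)]
    · push Not at h
      obtain ⟨i, hi⟩ := h
      have hle : Finsupp.single i D ≤ m := by simpa using hi
      have hm' : m = (m - Finsupp.single i D) + Finsupp.single i D :=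
        (tsub_add_cancel_of_le hle).symm
      set m' := m - Finsupp.single i D with hm'def
      have heq : restr (monomial m (1 : ℝ)) = restr (monomial m' 1 * r i) := by
        funext x
        rw [restr_apply, restr_apply, map_mul, ← hT x x.2 i, hm',
          show (monomial (m' + Finsupp.single i D) (1 : ℝ)) =
            monomial m' 1 * monomial (Finsupp.single i D) 1 by simp [monomial_mul], map_mul]
        congr 1
        simp [eval_monomial]
      rw [heq]
      have hdeg : (monomial m' (1 : ℝ)).totalDegree + D ≤ n := by
        refine le_trans ?_ hmn
        rw [totalDegree_monomial _ one_ne_zero, Finsupp.sum_fintype _ _ (fun _ => rfl), hm']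
        simp [Finset.sum_add_distrib, Finsupp.single_apply]
      have hlt := (totalDegree_mul (monomial m' (1 : ℝ)) (r i))
      have := hr i
      exact ih (monomial m' (1 : ℝ) * r i).totalDegree (by omega) _ le_rfl
  have hsep (x : T) : ∃ p : MvPolynomial ι ℝ, restr p = Pi.single x 1 := by
    let q : MvPolynomial ι ℝ := ∏ y ∈ T.erase x, ∑ i, (X i - C (y i)) ^ 2
    have hq : eval (x : ι → ℝ) q ≠ 0 := by
      simp only [q, map_prod, map_sum, map_pow, map_sub, eval_X, eval_C]
      refine Finset.prod_ne_zero_iff.2 fun y hy h0 => (Finset.mem_erase.1 hy).1 ?_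
      rw [Finset.sum_eq_zero_iff_of_nonneg (fun _ _ => sq_nonneg _)] at h0
      funext i
      have := h0 i (Finset.mem_univ _)
      have := pow_eq_zero_iff (two_ne_zero) |>.1 this
      linarith
    refine ⟨C (eval (x : ι → ℝ) q)⁻¹ * q, ?_⟩
    funext y
    rw [restr_apply, map_mul, eval_C]
    by_cases hy : y = x
    · subst hy
      simp [hq]
    · rw [Pi.single_eq_of_ne hy]
      have : eval (y : ι → ℝ) q = 0 := by
        simp only [q, map_prod, map_sum, map_pow, map_sub, eval_X, eval_C]
        refine Finset.prod_eq_zero (i := (y : ι → ℝ))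
          (Finset.mem_erase.2 ⟨fun h => hy (Subtype.ext h), y.2⟩) ?_
        simp
      rw [this, mul_zero]
  have htop : Submodule.span ℝ (Set.range mon) = ⊤ := by
    rw [eq_top_iff, ← (Pi.basisFun ℝ T).span_eq]
    refine Submodule.span_le.2 ?_
    rintro _ ⟨x, rfl⟩
    obtain ⟨p, hp⟩ := hsep x
    rw [Pi.basisFun_apply, ← hp]
    exact key _ p le_rfl
  have hrank := finrank_range_le_card (R := ℝ) mon
  rw [Set.finrank, htop, finrank_top, Module.finrank_fintype_fun_eq_card] at hrank
  simpa using hrank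

end MvPolynomial

namespace MvPolynomial

/-- Polynomials of degree at most `d` realize few strict sign patterns. -/
theorem card_strict_signPattern_le {ι κ : Type*} [Fintype ι] [Fintype κ] (q : κ → MvPolynomial ι ℝ)
    {d : ℕ} (hq : ∀ k, (q k).totalDegree ≤ d) (S : Finset (Finset κ))
    (hS : ∀ s ∈ S, ∃ x : ι → ℝ, ∀ k, (k ∈ s → 0 < eval x (q k)) ∧ (k ∉ s → eval x (q k) < 0)) :
    S.card ≤ (2 * (Fintype.card κ * d) + 1) ^ Fintype.card ι := by
  classical
  choose! u hu using hS
  set D := Fintype.card κ * d with hD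
  let G : MvPolynomial ι ℝ := ∏ k, q k
  have hGdeg : G.totalDegree ≤ D := by
    refine (totalDegree_finsetProd _ _).trans ((Finset.sum_le_sum fun k _ => hq k).trans ?_)
    simp [hD]
  have hG2 : (G ^ 2).totalDegree ≤ 2 * D :=
    (totalDegree_pow _ _).trans (Nat.mul_le_mul_left _ hGdeg)
  obtain ⟨ε, hε, hεS⟩ : ∃ ε : ℝ, 0 < ε ∧
      ∀ s ∈ S, ε * ∑ i, u s i ^ (2 * D + 2) < eval (u s) G ^ 2 := by
    have h : ∀ᶠ ε in nhdsWithin (0 : ℝ) (Set.Ioi 0),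
        ∀ s ∈ S, ε * ∑ i, u s i ^ (2 * D + 2) < eval (u s) G ^ 2 := by
      refine (Filter.eventually_all_finset S).2 fun s hs => nhdsWithin_le_nhds ?_
      have hc : Continuous fun ε : ℝ => ε * ∑ i, u s i ^ (2 * D + 2) := by fun_prop
      refine hc.continuousAt.eventually_lt continuousAt_const ?_
      rw [zero_mul]
      have : eval (u s) G ≠ 0 := by
        simp only [G, map_prod]
        refine Finset.prod_ne_zero_iff.2 fun k _ => ?_
        by_cases hk : k ∈ s
        · exact ((hu s hs k).1 hk).ne'
        · exact ((hu s hs k).2 hk).ne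
      positivity
    obtain ⟨ε, h1, h2⟩ := (h.and self_mem_nhdsWithin).exists
    exact ⟨ε, h2, h1⟩
  let Q : MvPolynomial ι ℝ := G ^ 2 - C ε * ∑ i, X i ^ (2 * D + 2)
  have hQ (x : ι → ℝ) : eval x Q = eval x G ^ 2 - ε * ∑ i, x i ^ (2 * D + 2) := by simp [Q]
  have hnonneg (x : ι → ℝ) : 0 ≤ ε * ∑ i, x i ^ (2 * D + 2) :=
    mul_nonneg hε.le (Finset.sum_nonneg fun i _ =>
      Even.pow_nonneg ⟨D + 1, by ring⟩ _)
  have hbdd : ∃ R : ℝ, ∀ x : ι → ℝ, 0 ≤ eval x Q → ‖x‖ ≤ R := by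
    obtain ⟨A, hA⟩ := exists_abs_eval_le G
    refine ⟨max 1 (A ^ 2 / ε), fun x hx => ?_⟩
    by_contra! hlt
    obtain ⟨h1, h2⟩ := max_lt_iff.1 hlt
    have hne : Nonempty ι := by
      by_contra hempty
      rw [not_nonempty_iff] at hempty
      rw [Subsingleton.elim x 0, norm_zero] at h1
      linarith
    obtain ⟨i, hi⟩ := Finite.exists_max fun i => |x i|
    have hxi : ‖x‖ ≤ |x i| := (pi_norm_le_iff_of_nonneg (abs_nonneg _)).2 hi
    have hsum : ‖x‖ ^ (2 * D + 2) ≤ ∑ i, x i ^ (2 * D + 2) := by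
      have he : Even (2 * D + 2) := ⟨D + 1, by ring⟩
      calc ‖x‖ ^ (2 * D + 2) ≤ |x i| ^ (2 * D + 2) := pow_le_pow_left₀ (norm_nonneg _) hxi _
        _ = x i ^ (2 * D + 2) := he.pow_abs _
        _ ≤ _ := Finset.single_le_sum (f := fun i => x i ^ (2 * D + 2))
          (fun i _ => he.pow_nonneg _) (Finset.mem_univ i)
    have hG : eval x G ^ 2 ≤ A ^ 2 * ‖x‖ ^ (2 * D) := by
      have h := hA x
      rw [max_eq_right h1.le] at h
      have hA0 : 0 ≤ A := by
        by_contra! hneg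
        have : 0 < ‖x‖ ^ G.totalDegree := by positivity
        nlinarith [abs_nonneg (eval x G)]
      have h' : |eval x G| ≤ A * ‖x‖ ^ D :=
        h.trans (mul_le_mul_of_nonneg_left (pow_le_pow_right₀ h1.le hGdeg) hA0)
      calc eval x G ^ 2 = |eval x G| ^ 2 := (sq_abs _).symm
        _ ≤ (A * ‖x‖ ^ D) ^ 2 := pow_le_pow_left₀ (abs_nonneg _) h' 2
        _ = _ := by ring
    rw [hQ] at hx
    have hpos : 0 < ‖x‖ ^ (2 * D) := by positivity
    have hmain : ε * ‖x‖ ^ 2 * ‖x‖ ^ (2 * D) ≤ A ^ 2 * ‖x‖ ^ (2 * D) := by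
      have := mul_le_mul_of_nonneg_left hsum hε.le
      calc ε * ‖x‖ ^ 2 * ‖x‖ ^ (2 * D) = ε * ‖x‖ ^ (2 * D + 2) := by ring
        _ ≤ _ := by linarith
    have h3 := le_of_mul_le_mul_right hmain hpos
    rw [div_lt_iff₀ hε] at h2
    nlinarith [mul_pos hε (sub_pos.2 h1)]
  obtain ⟨R, hR⟩ := hbdd
  have hcrit : ∀ s ∈ S, ∃ x : ι → ℝ,
      (∀ k, (k ∈ s → 0 < eval x (q k)) ∧ (k ∉ s → eval x (q k) < 0)) ∧
      ∀ i, eval x (pderiv i Q) = 0 := by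
    intro s hs
    let V : Set (ι → ℝ) := {x | ∀ k, (k ∈ s → 0 ≤ eval x (q k)) ∧ (k ∉ s → eval x (q k) ≤ 0)}
    let U : Set (ι → ℝ) := {x | ∀ k, (k ∈ s → 0 < eval x (q k)) ∧ (k ∉ s → eval x (q k) < 0)}
    have hUV : U ⊆ V := fun x hx k => ⟨fun hk => ((hx k).1 hk).le, fun hk => ((hx k).2 hk).le⟩
    have hV : IsClosed V := by
      simp only [V, Set.ofPred_forall, Set.ofPred_and]
      refine isClosed_iInter fun k => IsClosed.inter ?_ ?_
      · exact isClosed_iInter fun _ => isClosed_le continuous_const (continuous_eval _)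
      · exact isClosed_iInter fun _ => isClosed_le (continuous_eval _) continuous_const
    have hU : IsOpen U := by
      simp only [U, Set.ofPred_forall, Set.ofPred_and]
      refine isOpen_iInter_of_finite fun k => IsOpen.inter ?_ ?_
      · exact isOpen_iInter_of_finite fun _ => isOpen_lt continuous_const (continuous_eval _)
      · exact isOpen_iInter_of_finite fun _ => isOpen_lt (continuous_eval _) continuous_const
    have hQs : 0 < eval (u s) Q := by
      rw [hQ]
      linarith [hεS s hs]
    have hK : IsCompact (V ∩ {x | 0 ≤ eval x Q}) := by
      refine Metric.isCompact_of_isClosed_isBounded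
        (hV.inter (isClosed_le continuous_const (continuous_eval _))) ?_
      refine (Metric.isBounded_closedBall (x := (0 : ι → ℝ)) (r := R)).subset fun x hx => ?_
      rw [mem_closedBall_zero_iff]
      exact hR x hx.2
    obtain ⟨x, hx, hmax⟩ := hK.exists_isMaxOn ⟨u s, hUV (hu s hs), hQs.le⟩
      (continuous_eval Q).continuousOn
    have hxQ : 0 < eval x Q := hQs.trans_le (hmax ⟨hUV (hu s hs), hQs.le⟩)
    have hxG : eval x G ≠ 0 := by
      intro h0
      rw [hQ, h0] at hxQ
      linarith [hnonneg x]
    have hqx (k : κ) : eval x (q k) ≠ 0 := by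
      simp only [G, map_prod] at hxG
      exact Finset.prod_ne_zero_iff.1 hxG k (Finset.mem_univ k)
    have hxU : x ∈ U := fun k =>
      ⟨fun hk => ((hx.1 k).1 hk).lt_of_ne (hqx k).symm, fun hk => ((hx.1 k).2 hk).lt_of_ne (hqx k)⟩
    refine ⟨x, hxU, eval_pderiv_eq_zero_of_isLocalMax ?_⟩
    filter_upwards [hU.mem_nhds hxU] with y hy
    by_cases h0 : 0 ≤ eval y Q
    · exact hmax ⟨hUV hy, h0⟩
    · exact (not_le.1 h0).le.trans hxQ.le
  choose! v hv hv' using hcrit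
  have hinj : Set.InjOn v S := by
    intro s hs t ht hst
    ext k
    have h1 := hv s hs k
    have h2 := hv t ht k
    rw [← hst] at h2
    by_cases hks : k ∈ s <;> by_cases hkt : k ∈ t <;> simp only [hks, hkt]
    · exact absurd (h1.1 hks) (h2.2 hkt).not_gt
    · exact absurd (h2.1 hkt) (h1.2 hks).not_gt
  rw [← Finset.card_image_of_injOn hinj]
  have hc : (ε * (2 * D + 2 : ℕ) : ℝ) ≠ 0 := by positivity
  refine card_le_pow_of_forall_pow_eq_eval
    (fun i => C (ε * (2 * D + 2 : ℕ) : ℝ)⁻¹ * pderiv i (G ^ 2)) (fun i => ?_) _ fun x hx i => ?_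
  · refine lt_of_le_of_lt (totalDegree_mul _ _) ?_
    rw [totalDegree_C, zero_add]
    exact Nat.lt_succ_of_le ((totalDegree_pderiv_le _ _).trans hG2)
  · obtain ⟨s, hs, rfl⟩ := Finset.mem_image.1 hx
    have h := hv' s hs i
    have hsum : pderiv i (∑ j, (X j : MvPolynomial ι ℝ) ^ (2 * D + 2)) =
        C ((2 * D + 2 : ℕ) : ℝ) * X i ^ (2 * D + 1) := by
      rw [map_sum, Finset.sum_eq_single i]
      · rw [pderiv_pow, pderiv_X_self, mul_one, map_natCast]
        rfl
      · intro j _ hj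
        rw [pderiv_pow, pderiv_X_of_ne hj, mul_zero]
      · simp
    simp only [Q, map_sub, pderiv_C_mul, hsum, map_mul, eval_C, map_pow, eval_X] at h
    rw [map_mul, eval_C, eq_inv_mul_iff_mul_eq₀ hc]
    linarith

/-- Polynomials of degree at most `d` realize few positivity patterns. -/
theorem card_signPattern_le {ι κ : Type*} [Fintype ι] [Fintype κ] (p : κ → MvPolynomial ι ℝ)
    {d : ℕ} (hp : ∀ k, (p k).totalDegree ≤ d) (S : Finset (Finset κ))
    (hS : ∀ s ∈ S, ∃ x : ι → ℝ, ∀ k, k ∈ s ↔ 0 < eval x (p k)) :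
    S.card ≤ (2 * (Fintype.card κ * d) + 1) ^ Fintype.card ι := by
  choose! u hu using hS
  obtain ⟨δ, hδ, hδS⟩ : ∃ δ : ℝ, 0 < δ ∧ ∀ s ∈ S, ∀ k ∈ s, δ < eval (u s) (p k) := by
    have h : ∀ᶠ δ in nhdsWithin (0 : ℝ) (Set.Ioi 0),
        ∀ s ∈ S, ∀ k ∈ s, δ < eval (u s) (p k) := by
      refine (Filter.eventually_all_finset S).2 fun s hs =>
        (Filter.eventually_all_finset s).2 fun k hk => nhdsWithin_le_nhds ?_
      exact eventually_lt_nhds ((hu s hs k).1 hk)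
    obtain ⟨δ, h1, h2⟩ := (h.and self_mem_nhdsWithin).exists
    exact ⟨δ, h2, h1⟩
  refine card_strict_signPattern_le (fun k => p k - C δ)
    (fun k => (totalDegree_sub_C_le _ _).trans (hp k)) S fun s hs => ⟨u s, fun k => ⟨fun hk => ?_,
      fun hk => ?_⟩⟩
  · simpa using hδS s hs k hk
  · have := mt (hu s hs k).2 hk
    simp only [map_sub, eval_C]
    linarith

end MvPolynomial

/-- Forward pass of a network all of whose layers have width `W`, with weights `w l j (some k)`
and biases `w l j none`. -/
def paddedForward {W : ℕ} (w : ℕ → Fin W → Option (Fin W) → ℝ) (u : Fin W → ℝ) :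
    ℕ → Fin W → ℝ
  | 0 => u
  | l + 1 => fun j =>
      (∑ k, w l j (some k) *
        if l = 0 then paddedForward w u l k else max (paddedForward w u l k) 0) + w l j none

open MvPolynomial in
/-- As functions of the weights, the hidden states of a network on finitely many inputs are given
by one of few tuples of polynomials. -/
theorem exists_polynomials_paddedForward {W : ℕ} {ι I : Type*} [Fintype ι] [Fintype I]
    (e : ℕ → Fin W → Option (Fin W) → ι) (u : I → Fin W → ℝ) (L : ℕ) :
    ∀ l ≤ L, ∃ F : Finset (I → Fin W → MvPolynomial ι ℝ),
      F.card ≤ ((2 * (Fintype.card (I × Fin W) * L) + 1) ^ Fintype.card ι) ^ l ∧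
      (∀ P ∈ F, ∀ i j, (P i j).totalDegree ≤ l) ∧
      ∀ θ : ι → ℝ, ∃ P ∈ F, ∀ i j,
        paddedForward (fun l j k => θ (e l j k)) (u i) l j = eval θ (P i j) := by
  classical
  intro l
  induction l with
  | zero =>
    intro _
    refine ⟨{fun i j => C (u i j)}, by simp, by simp, fun θ => ⟨_, Finset.mem_singleton_self _, ?_⟩⟩
    intro i j
    rw [eval_C]
    rfl
  | succ l ih =>
    intro hl
    obtain ⟨F, hcard, hdeg, hrep⟩ := ih (by omega)
    let pats (P : I → Fin W → MvPolynomial ι ℝ) : Finset (Finset (I × Fin W)) :=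
      Finset.univ.filter fun s => ∃ θ : ι → ℝ, ∀ a, a ∈ s ↔ 0 < eval θ (P a.1 a.2)
    let next (P : I → Fin W → MvPolynomial ι ℝ) (s : Finset (I × Fin W)) :
        I → Fin W → MvPolynomial ι ℝ := fun i j =>
      (∑ k, X (e l j (some k)) * if l = 0 ∨ (i, k) ∈ s then P i k else 0) + X (e l j none)
    refine ⟨F.biUnion fun P => (pats P).image (next P), ?_, ?_, ?_⟩
    · rw [pow_succ]
      refine (Finset.card_biUnion_le_card_mul _ _ _ fun P hP => ?_).trans
        (Nat.mul_le_mul_right _ hcard)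
      refine Finset.card_image_le.trans
        (card_signPattern_le (fun a : I × Fin W => P a.1 a.2) (d := L) (fun a => ?_) _ fun s hs => ?_)
      · exact (hdeg P hP _ _).trans (by omega)
      · exact (Finset.mem_filter.1 hs).2
    · intro Q hQ i j
      obtain ⟨P, hP, hQ⟩ := Finset.mem_biUnion.1 hQ
      obtain ⟨s, -, rfl⟩ := Finset.mem_image.1 hQ
      refine (totalDegree_add _ _).trans (max_le (totalDegree_finsetSum_le fun k _ => ?_) ?_)
      · refine (totalDegree_mul _ _).trans ?_
        rw [totalDegree_X, add_comm]
        refine Nat.add_le_add_right ?_ 1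
        split_ifs
        · exact hdeg P hP i k
        · simp
      · rw [totalDegree_X]
        omega
    · intro θ
      obtain ⟨P, hP, hrepP⟩ := hrep θ
      let s : Finset (I × Fin W) := Finset.univ.filter fun a => 0 < eval θ (P a.1 a.2)
      have hs : ∀ a, a ∈ s ↔ 0 < eval θ (P a.1 a.2) := fun a => by simp [s]
      refine ⟨next P s, Finset.mem_biUnion.2 ⟨P, hP, Finset.mem_image.2
        ⟨s, Finset.mem_filter.2 ⟨Finset.mem_univ _, θ, hs⟩, rfl⟩⟩, fun i j => ?_⟩
      simp only [paddedForward, next, map_add, map_sum, map_mul, eval_X]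
      congr 1
      refine Finset.sum_congr rfl fun k _ => ?_
      congr 1
      rw [hrepP i k]
      by_cases h0 : l = 0
      · simp [h0]
      · simp only [h0, false_or, if_false, hs]
        split_ifs with h
        · exact max_eq_left h.le
        · rw [map_zero]
          exact max_eq_right (not_lt.1 h)

/-- The outputs of a network on finitely many inputs realize few positivity patterns. -/
theorem card_signPattern_paddedForward_le {W : ℕ} {ι I : Type*} [Fintype ι] [Fintype I]
    (e : ℕ → Fin W → Option (Fin W) → ι) (u : I → Fin W → ℝ) {L l : ℕ} (hl : l ≤ L) (j : Fin W)
    (S : Finset (Finset I))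
    (hS : ∀ s ∈ S, ∃ θ : ι → ℝ, ∀ i,
      i ∈ s ↔ 0 < paddedForward (fun l j k => θ (e l j k)) (u i) l j) :
    S.card ≤ ((2 * (Fintype.card I * W * L) + 1) ^ Fintype.card ι) ^ (l + 1) := by
  classical
  obtain ⟨F, hcard, hdeg, hrep⟩ := exists_polynomials_paddedForward e u L l hl
  choose! θ hθ using hS
  choose P hP hrepP using hrep
  have hW : 0 < W := j.pos
  have h := Finset.card_le_mul_card_image (f := fun s => P (θ s)) S
    ((2 * (Fintype.card I * W * L) + 1) ^ Fintype.card ι) fun p hp => by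
      obtain ⟨s₀, -, rfl⟩ := Finset.mem_image.1 hp
      refine (MvPolynomial.card_signPattern_le (fun i => P (θ s₀) i j) (d := L)
        (fun i => (hdeg _ (hP _) i j).trans hl) _ fun s hs => ?_).trans ?_
      · obtain ⟨hsS, hsP⟩ := Finset.mem_filter.1 hs
        refine ⟨θ s, fun i => ?_⟩
        rw [hθ s hsS i, hrepP (θ s) i j, hsP]
      · refine Nat.pow_le_pow_left ?_ _
        have : Fintype.card I * 1 * L ≤ Fintype.card I * W * L := by gcongr; exact hW
        rw [mul_one] at this
        omega
  refine h.trans ?_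
  rw [pow_succ, mul_comm]
  refine Nat.mul_le_mul_right _ (le_trans (Finset.card_le_card ?_) (hcard.trans ?_))
  · intro p hp
    obtain ⟨s, -, rfl⟩ := Finset.mem_image.1 hp
    exact hP _
  · rw [Fintype.card_prod, Fintype.card_fin]

namespace ReLUNet

/-- The network computing `x ↦ Φ (x + s)`. -/
abbrev translate {d : ℕ} (Φ : ReLUNet d) (s : Fin (Φ.width 0) → ℝ) : ReLUNet d where
  depth := Φ.depth
  depth_pos := Φ.depth_pos
  width := Φ.width
  width_in := Φ.width_in
  width_out := Φ.width_out
  A := Φ.A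
  b := fun i => if h : i = 0 then fun j => Φ.b i j + ∑ k, Φ.A i j k * s (Fin.cast (by rw [h]) k)
    else Φ.b i

theorem forward_translate {d : ℕ} (Φ : ReLUNet d) (s x : Fin (Φ.width 0) → ℝ) (i : ℕ) :
    (Φ.translate s).forward (i + 1) x = Φ.forward (i + 1) (x + s) := by
  induction i with
  | zero =>
    funext j
    change ∑ k, Φ.A 0 j k * x k + (Φ.b 0 j + ∑ k, Φ.A 0 j k * s k) =
      ∑ k, Φ.A 0 j k * (x k + s k) + Φ.b 0 j
    simp only [mul_add, Finset.sum_add_distrib]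
    ring
  | succ i ih =>
    funext j
    change Φ.layer (i + 1) (fun k => max ((Φ.translate s).forward (i + 1) x k) 0) j = _
    rw [ih]
    rfl

theorem continuous_forward {d : ℕ} (Φ : ReLUNet d) (i : ℕ) : Continuous (Φ.forward i) := by
  induction i with
  | zero => exact continuous_id
  | succ i ih =>
    have h (k) : Continuous fun x => Φ.forward i x k := (continuous_apply k).comp ih
    refine continuous_pi fun j => ?_
    simp only [forward, layer]
    refine Continuous.add (continuous_finsetSum _ fun k _ => continuous_const.mul ?_)
      continuous_const
    split_ifs
    · exact h k
    · exact (h k).max continuous_const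

/-- Padding the weights of a network with zeros does not change the forward pass. -/
theorem exists_paddedForward_eq (Φ : ReLUNet 1) {W L : ℕ} (hL : 0 < L) (hW : Φ.widthLe W)
    (hD : Φ.depth ≤ L) :
    ∃ θ : Fin L × Fin W × Option (Fin W) → ℝ, ∀ t : ℝ, ∀ l (hl : l ≤ Φ.depth),
      ∀ j : Fin (Φ.width l),
        paddedForward (fun l j k => θ (⟨l % L, Nat.mod_lt _ hL⟩, j, k)) (fun _ => t) l
          (Fin.castLE (hW l hl) j) = Φ.forward l (fun _ => t) j := by
  let θ : Fin L × Fin W × Option (Fin W) → ℝ := fun a =>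
    if h : (a.2.1 : ℕ) < Φ.width (a.1 + 1) then
      a.2.2.elim (Φ.b a.1 ⟨a.2.1, h⟩) fun k =>
        if hk : (k : ℕ) < Φ.width a.1 then Φ.A a.1 ⟨a.2.1, h⟩ ⟨k, hk⟩ else 0
    else 0
  have hb (l : Fin L) (hl : (l : ℕ) + 1 ≤ Φ.depth) (j : Fin (Φ.width (l + 1))) :
      θ (l, Fin.castLE (hW _ hl) j, none) = Φ.b l j := by
    simp [θ]
  have hA (l : Fin L) (hl : (l : ℕ) + 1 ≤ Φ.depth) (j : Fin (Φ.width (l + 1))) (k : Fin W) :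
      θ (l, Fin.castLE (hW _ hl) j, some k) =
        if hk : (k : ℕ) < Φ.width l then Φ.A l j ⟨k, hk⟩ else 0 := by
    simp [θ]
  refine ⟨θ, fun t l => ?_⟩
  induction l with
  | zero => exact fun _ _ => rfl
  | succ l ih =>
    intro hl j
    have hlL : l < L := by omega
    have hmod : (⟨l % L, Nat.mod_lt _ hL⟩ : Fin L) = ⟨l, hlL⟩ := Fin.ext (Nat.mod_eq_of_lt hlL)
    have hle : Φ.width l ≤ W := hW l (by omega)
    simp only [paddedForward, forward, layer, hmod]
    rw [hb ⟨l, hlL⟩ hl j]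
    congr 1
    symm
    refine Finset.sum_of_injOn (Fin.castLE hle) (Fin.castLE_injective hle).injOn (by simp) ?_ ?_
    · intro k _ hk
      rw [hA ⟨l, hlL⟩ hl j k, dif_neg, zero_mul]
      intro h
      exact hk ⟨⟨k, h⟩, by simp, rfl⟩
    · intro k _
      rw [hA ⟨l, hlL⟩ hl j, ih (by omega) k]
      simp

end ReLUNet

theorem continuous_of_mem_Rclass₁ {W L : ℕ} {f : ℝ → ℝ} (hf : f ∈ Rclass₁ W L) :
    Continuous f := by
  obtain ⟨_, ⟨Φ, -, -, rfl⟩, rfl⟩ := hf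
  exact (continuous_apply _).comp ((Φ.continuous_forward _).comp
    (continuous_pi fun _ => continuous_id))

/-- Translates of networks of width `W` and depth `L` realize few positivity patterns on a finite
set of inputs. -/
theorem card_signPattern_Rclass₁_le {N W L : ℕ} (hN : 0 < N) (hW : 0 < W) (hL : 0 < L)
    (c : Fin N → ℝ) (S : Finset (Finset (Fin N)))
    (hS : ∀ s ∈ S, ∃ f ∈ Rclass₁ W L, ∃ t : ℝ, ∀ i, i ∈ s ↔ 0 < f (c i + t)) :
    S.card ≤ (2 * (N * W * L) + 1) ^ (L * (W * (W + 1)) * (L + 2)) := by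
  classical
  have hθ : ∀ s ∈ S, ∃ D ≤ L, ∃ θ : Fin L × Fin W × Option (Fin W) → ℝ, ∀ i, i ∈ s ↔
      0 < paddedForward (fun l j k => θ (⟨l % L, Nat.mod_lt _ hL⟩, j, k)) (fun _ => c i) D
        ⟨0, hW⟩ := by
    intro s hs
    obtain ⟨_, ⟨_, ⟨Φ, hΦW, hΦL, rfl⟩, rfl⟩, t, hst⟩ := hS s hs
    obtain ⟨θ, hθ⟩ := (Φ.translate fun _ => t).exists_paddedForward_eq hL
      (show (Φ.translate fun _ => t).widthLe W from hΦW) hΦL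
    refine ⟨Φ.depth, hΦL, θ, fun i => ?_⟩
    have h := hθ (c i) Φ.depth le_rfl (Fin.cast Φ.width_out.symm 0)
    have hcast : Fin.castLE (hΦW Φ.depth le_rfl) (Fin.cast Φ.width_out.symm 0) = ⟨0, hW⟩ := rfl
    have hforward : (Φ.translate fun _ => t).forward Φ.depth (fun _ => c i) =
        Φ.forward Φ.depth fun _ => c i + t := by
      obtain ⟨D, hD⟩ := Nat.exists_eq_succ_of_ne_zero Φ.depth_pos.ne'
      rw [hD]
      exact Φ.forward_translate (fun _ => t) (fun _ => c i) D
    rw [hst i]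
    change 0 < Φ.forward Φ.depth (fun _ => c i + t) (Fin.cast Φ.width_out.symm 0) ↔ _
    rw [← hforward]
    exact (congrArg (0 < ·) h).symm.to_iff
  choose! D hD θ hθ using hθ
  set M := (2 * (N * W * L) + 1) ^ (L * (W * (W + 1))) with hM
  have hι : Fintype.card (Fin L × Fin W × Option (Fin W)) = L * (W * (W + 1)) := by simp
  have h := Finset.card_le_mul_card_image (f := D) S (M ^ (L + 1)) fun l hl => by
    obtain ⟨s₀, hs₀, rfl⟩ := Finset.mem_image.1 hl
    have := card_signPattern_paddedForward_le 
      (fun l j k => ((⟨l % L, Nat.mod_lt _ hL⟩, j, k) : Fin L × Fin W × Option (Fin W)))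
      (fun i _ => c i) (hD s₀ hs₀) ⟨0, hW⟩ (S.filter fun s => D s = D s₀) fun s hs => by
        obtain ⟨hsS, hsD⟩ := Finset.mem_filter.1 hs
        refine ⟨θ s, fun i => ?_⟩
        rw [← hsD]
        exact hθ s hsS i
    rw [hι, Fintype.card_fin] at this
    exact this.trans (Nat.pow_le_pow_right (by positivity) (Nat.succ_le_succ (hD s₀ hs₀)))
  have himage : (S.image D).card ≤ L + 1 := by
    rw [← Finset.card_range (L + 1)]
    refine Finset.card_le_card fun l hl => ?_
    obtain ⟨s, hs, rfl⟩ := Finset.mem_image.1 hl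
    exact Finset.mem_range.2 (Nat.lt_succ_of_le (hD s hs))
  have hLM : L + 1 ≤ M := by
    have h1 : 1 * 1 * L ≤ N * W * L := by gcongr <;> assumption
    refine le_trans ?_ (Nat.le_self_pow (by positivity) _)
    omega
  calc S.card ≤ M ^ (L + 1) * (L + 1) := h.trans (Nat.mul_le_mul_left _ himage)
    _ ≤ M ^ (L + 1) * M := Nat.mul_le_mul_left _ hLM
    _ = _ := by rw [hM, ← pow_succ, ← pow_mul]

/-- The points lying in the `N`-cells indexed by `s`, together with the cell `[-1/N, 0)`. -/
def cellUnion (N : ℕ) (s : Finset (Fin N)) : Set ℝ :=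
  {x | ⌊(N : ℝ) * x⌋ = -1 ∨ ∃ i ∈ s, ⌊(N : ℝ) * x⌋ = (i : ℕ)}

/-- Half the signed distance to the boundary of `cellUnion N s`, positive inside. -/
def cellSignedDist (N : ℕ) (s : Finset (Fin N)) (x : ℝ) : ℝ :=
  (Metric.infDist x (cellUnion N s)ᶜ - Metric.infDist x (cellUnion N s)) / 2

theorem continuous_cellSignedDist (N : ℕ) (s : Finset (Fin N)) :
    Continuous (cellSignedDist N s) :=
  ((Metric.continuous_infDist_pt _).sub (Metric.continuous_infDist_pt _)).div_const 2

theorem neg_inv_mem_cellUnion {N : ℕ} (hN : 0 < N) (s : Finset (Fin N)) :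
    -(N : ℝ)⁻¹ ∈ cellUnion N s := by
  left
  have : (N : ℝ) * -(N : ℝ)⁻¹ = ((-1 : ℤ) : ℝ) := by
    have : (N : ℝ) ≠ 0 := by positivity
    field_simp
    norm_num
  rw [this, Int.floor_intCast]

theorem one_mem_compl_cellUnion (N : ℕ) (s : Finset (Fin N)) : (1 : ℝ) ∈ (cellUnion N s)ᶜ := by
  rintro (h | ⟨i, -, h⟩)
  · rw [mul_one, Int.floor_natCast] at h
    omega
  · rw [mul_one, Int.floor_natCast] at h
    have := i.2
    omega

theorem cellSignedDist_mem_H1 {N : ℕ} (hN : 0 < N) (s : Finset (Fin N)) :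
    cellSignedDist N s ∈ H1 := by
  refine ⟨(continuous_cellSignedDist N s).continuousOn, fun x hx => ?_, fun x _ y _ => ?_⟩
  · have h1 := Metric.infDist_le_dist_of_mem (x := x) (neg_inv_mem_cellUnion hN s)
    have h2 := Metric.infDist_le_dist_of_mem (x := x) (one_mem_compl_cellUnion N s)
    have h3 : 0 ≤ Metric.infDist x (cellUnion N s) := Metric.infDist_nonneg
    have h4 : 0 ≤ Metric.infDist x (cellUnion N s)ᶜ := Metric.infDist_nonneg
    have h5 : (N : ℝ)⁻¹ ≤ 1 := inv_le_one_of_one_le₀ (by exact_mod_cast hN)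
    have h6 : 0 ≤ (N : ℝ)⁻¹ := by positivity
    rw [Real.dist_eq, abs_of_nonneg (by linarith [hx.1])] at h1
    rw [Real.dist_eq, abs_of_nonpos (by linarith [hx.2])] at h2
    rw [cellSignedDist, abs_le]
    constructor <;> linarith [hx.1, hx.2]
  · have h1 := (Metric.lipschitz_infDist_pt (cellUnion N s)).dist_le_mul x y
    have h2 := (Metric.lipschitz_infDist_pt (cellUnion N s)ᶜ).dist_le_mul x y
    simp only [NNReal.coe_one, one_mul, Real.dist_eq] at h1 h2
    rw [abs_le] at h1 h2
    rw [cellSignedDist, cellSignedDist, abs_le]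
    constructor <;> linarith [h1.1, h1.2, h2.1, h2.2]

theorem inv_four_mul_le_dist_of_floor_ne {N : ℕ} (hN : 0 < N) {i : ℕ} {t y : ℝ} (ht : 1 / 4 ≤ t)
    (ht' : t ≤ 3 / 4) (hy : ⌊(N : ℝ) * y⌋ ≠ i) :
    1 / (4 * (N : ℝ)) ≤ dist ((i : ℝ) / N + t / N) y := by
  by_contra! hlt
  have hN' : (0 : ℝ) < N := by exact_mod_cast hN
  apply hy
  rw [Real.dist_eq, lt_div_iff₀ (by positivity)] at hlt
  have h : |(i : ℝ) + t - N * y| < 1 / 4 := by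
    have : (i : ℝ) + t - N * y = N * ((i : ℝ) / N + t / N - y) := by field_simp
    rw [this, abs_mul, abs_of_pos hN']
    linarith
  rw [abs_lt] at h
  rw [Int.floor_eq_iff]
  constructor
  · push_cast
    linarith [h.1, h.2]
  · push_cast
    linarith [h.1, h.2]

theorem floor_mul_div_add_div {N : ℕ} (hN : 0 < N) (i : ℕ) {t : ℝ} (ht : 0 ≤ t) (ht' : t < 1) :
    ⌊(N : ℝ) * ((i : ℝ) / N + t / N)⌋ = i := by
  have hN' : (N : ℝ) ≠ 0 := by positivity
  have : (N : ℝ) * ((i : ℝ) / N + t / N) = i + t := by field_simp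
  rw [this, Int.floor_eq_iff]
  constructor <;> push_cast <;> linarith

theorem le_cellSignedDist {N : ℕ} {s : Finset (Fin N)} {i : Fin N} (hi : i ∈ s) {t : ℝ}
    (ht : 1 / 4 ≤ t) (ht' : t ≤ 3 / 4) :
    1 / (8 * (N : ℝ)) ≤ cellSignedDist N s ((i : ℕ) / N + t / N) := by
  have hN : 0 < N := i.pos
  have hmem : ((i : ℕ) : ℝ) / N + t / N ∈ cellUnion N s :=
    Or.inr ⟨i, hi, floor_mul_div_add_div hN i (by linarith) (by linarith)⟩
  have h : 1 / (4 * (N : ℝ)) ≤ Metric.infDist (((i : ℕ) : ℝ) / N + t / N) (cellUnion N s)ᶜ :=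
    (Metric.le_infDist ⟨1, one_mem_compl_cellUnion N s⟩).2 fun y hy =>
      inv_four_mul_le_dist_of_floor_ne hN ht ht' fun h => hy (Or.inr ⟨i, hi, h⟩)
  rw [cellSignedDist, Metric.infDist_zero_of_mem hmem, sub_zero]
  calc 1 / (8 * (N : ℝ)) = 1 / (4 * (N : ℝ)) / 2 := by rw [div_div]; ring
    _ ≤ _ := by linarith

theorem cellSignedDist_le {N : ℕ} {s : Finset (Fin N)} {i : Fin N} (hi : i ∉ s) {t : ℝ}
    (ht : 1 / 4 ≤ t) (ht' : t ≤ 3 / 4) :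
    cellSignedDist N s ((i : ℕ) / N + t / N) ≤ -(1 / (8 * (N : ℝ))) := by
  have hN : 0 < N := i.pos
  have hmem : ((i : ℕ) : ℝ) / N + t / N ∈ (cellUnion N s)ᶜ := by
    have hfloor := floor_mul_div_add_div hN i (t := t) (by linarith) (by linarith)
    rintro (h | ⟨j, hj, h⟩)
    · omega
    · rw [hfloor] at h
      have : i = j := Fin.ext (by exact_mod_cast h)
      exact hi (this ▸ hj)
  have h : 1 / (4 * (N : ℝ)) ≤ Metric.infDist (((i : ℕ) : ℝ) / N + t / N) (cellUnion N s) := by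
    refine (Metric.le_infDist ⟨_, neg_inv_mem_cellUnion hN s⟩).2 fun y hy =>
      inv_four_mul_le_dist_of_floor_ne hN ht ht' fun h => ?_
    rcases hy with hy | ⟨j, hj, hy⟩
    · omega
    · rw [h] at hy
      have : i = j := Fin.ext (by exact_mod_cast hy)
      exact hi (this ▸ hj)
  rw [cellSignedDist, Metric.infDist_zero_of_mem hmem, zero_sub]
  calc -_ / 2 ≤ -(1 / (4 * (N : ℝ)) / 2) := by linarith
    _ = -(1 / (8 * (N : ℝ))) := by rw [div_div]; ring

/-- Some translate of the grid, staying in the middle halves of the cells, samples a function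
about as well as integration does. -/
theorem exists_sum_le_of_integral_lt {F : ℝ → ℝ} (hF : Continuous F) (hF0 : ∀ x, 0 ≤ F x) {N : ℕ}
    (hN : 0 < N) {η : ℝ} (hη : ∫ x in (0 : ℝ)..1, F x < η) :
    ∃ t : ℝ, 1 / 4 ≤ t ∧ t ≤ 3 / 4 ∧ ∑ i : Fin N, F ((i : ℕ) / N + t / N) ≤ 2 * N * η := by
  by_contra! hcon
  have hN' : (0 : ℝ) < N := by exact_mod_cast hN
  let G : ℝ → ℝ := fun t => ∑ i ∈ Finset.range N, F (t / N + i / N)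
  have hG : Continuous G := by fun_prop
  have hGint (a b : ℝ) : IntervalIntegrable G volume a b := hG.intervalIntegrable a b
  have hG1 : ∫ t in (0 : ℝ)..1, G t = N * ∫ x in (0 : ℝ)..1, F x := by
    have hcell (i : ℕ) : ∫ t in (0 : ℝ)..1, F (t / N + i / N) =
        N * ∫ x in ((i : ℕ) : ℝ) / N..((i + 1 : ℕ) : ℝ) / N, F x := by
      rw [intervalIntegral.integral_comp_div_add _ hN'.ne', smul_eq_mul, zero_div, zero_add]
      congr 2
      push_cast
      ring
    rw [intervalIntegral.integral_finsetSum fun i _ =>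
      Continuous.intervalIntegrable (by fun_prop) _ _]
    simp only [hcell]
    rw [← Finset.mul_sum, intervalIntegral.sum_integral_adjacent_intervals
      (a := fun i : ℕ => (i : ℝ) / N) fun _ _ => hF.intervalIntegrable _ _]
    simp [hN'.ne']
  have hlow : ∫ _ in (1 / 4 : ℝ)..3 / 4, 2 * N * η ≤ ∫ t in (1 / 4 : ℝ)..3 / 4, G t := by
    refine intervalIntegral.integral_mono_on (by norm_num) (by simp) (hGint _ _) fun t ht => ?_
    refine (hcon t ht.1 ht.2).le.trans (le_of_eq ?_)
    rw [Fin.sum_univ_eq_sum_range (fun i : ℕ => F ((i : ℝ) / N + t / N))]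
    exact Finset.sum_congr rfl fun i _ => by rw [add_comm]
  have hmono : ∫ t in (1 / 4 : ℝ)..3 / 4, G t ≤ ∫ t in (0 : ℝ)..1, G t :=
    intervalIntegral.integral_mono_interval (by norm_num) (by norm_num) (by norm_num)
      (Filter.Eventually.of_forall fun t => Finset.sum_nonneg fun i _ => hF0 _) (hGint _ _)
  rw [intervalIntegral.integral_const, smul_eq_mul] at hlow
  nlinarith

theorem integral_sq_lt_of_intervalDist_lt {f g : ℝ → ℝ} (hf : Continuous f) (hg : Continuous g)
    {ε : ℝ} (h : intervalDist 2 f g < ENNReal.ofReal ε) :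
    ∫ x in (0 : ℝ)..1, (f x - g x) ^ 2 < ε ^ 2 := by
  have hε : 0 < ε := ENNReal.ofReal_pos.1 (pos_of_gt h)
  rw [intervalIntegral.integral_of_le zero_le_one, ← integral_Icc_eq_integral_Ioc]
  have hint : IntegrableOn (fun x => (f x - g x) ^ 2) (Set.Icc 0 1) :=
    Continuous.integrableOn_Icc (by fun_prop)
  have hlint := ofReal_integral_eq_lintegral_ofReal hint
    (Filter.Eventually.of_forall fun x => sq_nonneg (f x - g x))
  rw [← ENNReal.ofReal_lt_ofReal_iff (by positivity), hlint, ENNReal.ofReal_pow hε.le]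
  refine lt_of_eq_of_lt ?_ (ENNReal.pow_lt_pow_left two_ne_zero h)
  rw [intervalDist, eLpNorm_eq_lintegral_rpow_enorm_toReal two_ne_zero ENNReal.ofNat_ne_top,
    ← ENNReal.rpow_natCast, ← ENNReal.rpow_mul]
  norm_num
  refine lintegral_congr fun x => ?_
  rw [Real.enorm_eq_ofReal_abs, ← ENNReal.ofReal_pow (abs_nonneg _), sq_abs]

theorem card_filter_card_le (k : ℕ) :
    (Finset.univ.filter fun s : Finset (Fin (16 * k)) => s.card ≤ k).card ≤ 2 ^ (6 * k) := by
  set B := Finset.univ.filter fun s : Finset (Fin (16 * k)) => s.card ≤ k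
  have h := Finset.sum_pow_mul_eq_add_pow 1 8 (Finset.univ : Finset (Fin (16 * k)))
  rw [Finset.card_univ, Fintype.card_fin] at h
  have hB : B.card * 8 ^ (15 * k) ≤ (1 + 8) ^ (16 * k) := by
    rw [← h, ← smul_eq_mul, ← Finset.sum_const]
    refine (Finset.sum_le_sum fun s hs => ?_).trans
      (Finset.sum_le_sum_of_subset (fun s _ => by simp))
    have := (Finset.mem_filter.1 hs).2
    rw [one_pow, one_mul]
    exact Nat.pow_le_pow_right (by norm_num) (by omega)
  refine Nat.le_of_mul_le_mul_right (hB.trans ?_) (show 0 < 8 ^ (15 * k) by positivity)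
  rw [pow_mul, pow_mul, pow_mul, ← mul_pow]
  exact Nat.pow_le_pow_left (by norm_num) k

/-- A family of sets that approximates every set up to few elements is large. -/
theorem two_pow_le_card_mul_of_forall_exists_symmDiff {k : ℕ}
    (S : Finset (Finset (Fin (16 * k)))) (h : ∀ s, ∃ t ∈ S, (symmDiff s t).card ≤ k) :
    2 ^ (16 * k) ≤ S.card * 2 ^ (6 * k) := by
  choose t ht hst using h
  have hinj : Function.Injective fun s => (t s, symmDiff s (t s)) := by
    intro s s' hss
    obtain ⟨h1, h2⟩ := Prod.ext_iff.1 hss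
    simp only at h1 h2
    rw [h1] at h2
    exact symmDiff_left_injective _ h2
  have hcard := Finset.card_le_card_of_injOn (s := Finset.univ)
    (t := S ×ˢ Finset.univ.filter fun s : Finset (Fin (16 * k)) => s.card ≤ k)
    (fun s => (t s, symmDiff s (t s))) (fun s _ => by simp [ht, hst]) hinj.injOn
  rw [Finset.card_product, Finset.card_univ, Fintype.card_finset, Fintype.card_fin] at hcard
  exact hcard.trans (Nat.mul_le_mul_left _ (card_filter_card_le k))

/-- If networks approximate all 1-Lipschitz functions well, they realize, up to small errors, all
positivity patterns on a grid. -/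
theorem exists_signPattern_symmDiff_card_le {N k W L : ℕ} (hk : 0 < k) (hNk : N = 16 * k)
    (h : minimaxErr H1 (Rclass₁ W L) (intervalDist 2) < ENNReal.ofReal (1 / (64 * N)))
    (s : Finset (Fin N)) :
    ∃ s' : Finset (Fin N), (∃ f ∈ Rclass₁ W L, ∃ t : ℝ,
      ∀ i, i ∈ s' ↔ 0 < f ((i : ℕ) / N + t)) ∧ (symmDiff s s').card ≤ k := by
  classical
  have hN : 0 < N := by omega
  have hN' : (0 : ℝ) < N := by exact_mod_cast hN
  set g := cellSignedDist N s
  have hg : (⨅ f ∈ Rclass₁ W L, intervalDist 2 f g) < ENNReal.ofReal (1 / (64 * N)) :=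
    (le_iSup₂ (f := fun g (_ : g ∈ H1) => ⨅ f ∈ Rclass₁ W L, intervalDist 2 f g) g
      (cellSignedDist_mem_H1 hN s)).trans_lt h
  simp only [iInf_lt_iff] at hg
  obtain ⟨f, hf, hfg⟩ := hg
  have hfc := continuous_of_mem_Rclass₁ hf
  have hgc := continuous_cellSignedDist N s
  obtain ⟨t, ht, ht', hsum⟩ := exists_sum_le_of_integral_lt
    (F := fun x => (f x - g x) ^ 2) (by fun_prop) (fun x => sq_nonneg _) hN
    (integral_sq_lt_of_intervalDist_lt hfc hgc hfg)
  let s' : Finset (Fin N) := Finset.univ.filter fun i => 0 < f ((i : ℕ) / N + t / N)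
  have hs' (i : Fin N) : i ∈ s' ↔ 0 < f ((i : ℕ) / N + t / N) := by simp [s']
  refine ⟨s', ⟨f, hf, t / N, hs'⟩, ?_⟩
  have hdis (i) (hi : i ∈ symmDiff s s') :
      (1 / (8 * (N : ℝ))) ^ 2 ≤ (f ((i : ℕ) / N + t / N) - g ((i : ℕ) / N + t / N)) ^ 2 := by
    have hpos : 0 < 1 / (8 * (N : ℝ)) := by positivity
    rcases Finset.mem_symmDiff.1 hi with ⟨h1, h2⟩ | ⟨h1, h2⟩
    · have h3 := le_cellSignedDist h1 ht ht'
      have h4 := not_lt.1 (mt (hs' i).2 h2)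
      nlinarith
    · have h3 := cellSignedDist_le h2 ht ht'
      have h4 := (hs' i).1 h1
      nlinarith
  have hcount : (symmDiff s s').card * (1 / (8 * (N : ℝ))) ^ 2 ≤ 2 * N * (1 / (64 * N)) ^ 2 := by
    rw [← nsmul_eq_mul, ← Finset.sum_const]
    exact ((Finset.sum_le_sum hdis).trans (Finset.sum_le_sum_of_subset_of_nonneg
      (Finset.subset_univ _) fun i _ _ => sq_nonneg _)).trans hsum
  have hfinal : ((symmDiff s s').card : ℝ) ≤ k := by
    have hNk' : (N : ℝ) = 16 * k := by rw [hNk]; push_cast; ring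
    have e1 : ((symmDiff s s').card : ℝ) * (1 / (8 * (N : ℝ))) ^ 2 * (64 * N ^ 2) =
        (symmDiff s s').card := by field_simp; norm_num
    have e2 : 2 * N * (1 / (64 * (N : ℝ))) ^ 2 * (64 * N ^ 2) = N / 32 := by field_simp; norm_num
    have := mul_le_mul_of_nonneg_right hcount (show 0 ≤ 64 * (N : ℝ) ^ 2 by positivity)
    rw [e1, e2, hNk'] at this
    have : (0 : ℝ) ≤ k := by positivity
    linarith
  exact_mod_cast hfinal

theorem inv_le_minimaxErr_H1_Rclass₁ {W L k : ℕ} (hW : 2 ≤ W) (hL : 2 ≤ L)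
    (hk : k = 32 * (W * L) ^ 2 * (Nat.log 2 (W * L) + 1)) :
    ENNReal.ofReal (1 / (64 * (16 * k : ℕ))) ≤
      minimaxErr H1 (Rclass₁ W L) (intervalDist 2) := by
  classical
  by_contra! hlt
  set a := W * L with ha
  set m := Nat.log 2 a + 1 with hm
  have ha4 : 4 ≤ a := by nlinarith
  have ham : a < 2 ^ m := Nat.lt_pow_succ_log_self (by norm_num) a
  have hm3 : 3 ≤ m := by
    have : Nat.log 2 4 ≤ Nat.log 2 a := Nat.log_mono_right ha4
    have h4 : Nat.log 2 4 = 2 := by decide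
    omega
  have hk0 : 0 < k := by rw [hk]; positivity
  let S : Finset (Finset (Fin (16 * k))) := Finset.univ.filter fun s =>
    ∃ f ∈ Rclass₁ W L, ∃ t : ℝ, ∀ i, i ∈ s ↔ 0 < f ((i : ℕ) / (16 * k : ℕ) + t)
  have hlow := two_pow_le_card_mul_of_forall_exists_symmDiff S fun s => by
    obtain ⟨s', hs', hcard⟩ := exists_signPattern_symmDiff_card_le hk0 rfl hlt s
    exact ⟨s', Finset.mem_filter.2 ⟨Finset.mem_univ _, hs'⟩, hcard⟩
  have hup := card_signPattern_Rclass₁_le (N := 16 * k) (W := W) (L := L) (by omega) (by omega)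
    (by omega) (fun i => (i : ℕ) / (16 * k : ℕ)) S fun s hs => (Finset.mem_filter.1 hs).2
  have hbase : 2 * (16 * k * W * L) + 1 ≤ 2 ^ (8 * m) := by
    have h1 : 2 * (16 * k * W * L) + 1 ≤ 4 * (16 * k * a) := by
      have : 0 < k * a := by positivity
      rw [mul_assoc _ W L]
      nlinarith
    have h2 : 4 * (16 * k * a) = 2 ^ 11 * (a ^ 3 * m) := by rw [hk]; ring
    have h3 : a ^ 3 * m ≤ (2 ^ m) ^ 3 * 2 ^ m :=
      Nat.mul_le_mul (Nat.pow_le_pow_left ham.le 3) Nat.lt_two_pow_self.le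
    calc _ ≤ 2 ^ 11 * ((2 ^ m) ^ 3 * 2 ^ m) := by rw [h2] at h1; exact h1.trans (by gcongr)
      _ = 2 ^ (11 + 4 * m) := by ring
      _ ≤ 2 ^ (8 * m) := Nat.pow_le_pow_right (by norm_num) (by omega)
  have hexp : L * (W * (W + 1)) * (L + 2) ≤ 4 * a ^ 2 := by
    calc L * (W * (W + 1)) * (L + 2) ≤ L * (W * (2 * W)) * (2 * L) := by gcongr <;> omega
      _ = 4 * a ^ 2 := by rw [ha]; ring
  have hS : S.card ≤ 2 ^ k := by
    calc S.card ≤ (2 ^ (8 * m)) ^ (4 * a ^ 2) := hup.trans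
          ((Nat.pow_le_pow_left hbase _).trans (Nat.pow_le_pow_right (by positivity) hexp))
      _ = 2 ^ k := by rw [← pow_mul, hk]; congr 1; ring
  have h7 : 2 ^ (16 * k) ≤ 2 ^ (7 * k) := by
    calc 2 ^ (16 * k) ≤ 2 ^ k * 2 ^ (6 * k) := hlow.trans (Nat.mul_le_mul_right _ hS)
      _ = 2 ^ (7 * k) := by ring
  have := (Nat.pow_le_pow_iff_right (by norm_num : 1 < 2)).1 h7
  omega

/-- Lower bound on the minimax error in approximating 1-Lipschitz
functions by deep ReLU networks with unconstrained weight magnitude: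
`A(H¹([0,1]), R(1,W,L), ‖·‖_{L²([0,1])}) ≥ min{1/8, C (W²L² (log(WL))²)⁻¹}`. -/
theorem lipschitz_approximation_lower_bound_unbounded_weights :
    ∃ C : ℝ, 0 < C ∧
      ∀ (W L : ℕ), 2 ≤ W → 2 ≤ L →
        ENNReal.ofReal
            (min (1 / 8)
              (C * ((W : ℝ) ^ 2 * (L : ℝ) ^ 2 *
                (Real.logb 2 ((W : ℝ) * (L : ℝ))) ^ 2)⁻¹))
          ≤ minimaxErr H1 (Rclass₁ W L) (intervalDist 2) := by

  refine ⟨1 / 65536, by norm_num, fun W L hW hL => ?_⟩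
  refine le_trans (ENNReal.ofReal_le_ofReal ((min_le_right _ _).trans ?_))
    (inv_le_minimaxErr_H1_Rclass₁ hW hL rfl)
  have ha4 : 4 ≤ W * L := by nlinarith
  have hlog : (Nat.log 2 (W * L) : ℝ) ≤ Real.logb 2 ((W : ℝ) * L) := by
    have := Real.natLog_le_logb (W * L) 2
    push_cast at this
    exact this
  have hlog1 : 1 ≤ Nat.log 2 (W * L) := Nat.log_pos (by norm_num) (by omega)
  have hlog1' : (1 : ℝ) ≤ Nat.log 2 (W * L) := by exact_mod_cast hlog1
  set ℓ := Real.logb 2 ((W : ℝ) * L)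
  have hW0 : (0 : ℝ) < W := by positivity
  have hL0 : (0 : ℝ) < L := by positivity
  have hℓ : (Nat.log 2 (W * L) : ℝ) + 1 ≤ 2 * ℓ ^ 2 := by nlinarith
  rw [← one_div, div_mul_div_comm, one_mul]
  refine one_div_le_one_div_of_le (by positivity) ?_
  push_cast
  calc 64 * (16 * (32 * ((W : ℝ) * L) ^ 2 * ((Nat.log 2 (W * L) : ℝ) + 1)))
      ≤ 64 * (16 * (32 * ((W : ℝ) * L) ^ 2 * (2 * ℓ ^ 2))) := by gcongr
    _ = 65536 * ((W : ℝ) ^ 2 * (L : ℝ) ^ 2 * ℓ ^ 2) := by ring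
end
end
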